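/- arXiv:math/0412466 — 2 statements merged into one kernel-verified Lean document; each statement's English description precedes it below -/
import Mathlib

section
/- Let H = (h_0, …, h_j) be the Hilbert function of a graded Artinian Gorenstein quotient of a polynomial ring K[x_1, …, x_r] of socle degree j. If for some d < j one has h_{d+1} = (h_d)^{(d)} (extremal growth in Macaulay's inequality), then the first-difference sequence (Δh_0, Δh_1, …, Δh_{d+1}), where Δh_0 = 1 and Δh_i = h_i − h_{i−1}, consists of nonnegative integers and is an O-sequence. -/
open MvPolynomial

noncomputable section

/-- The Hilbert function of the graded quotient `R/I`, where
`R = K[x_1,...,x_n]`: the dimension of the image in `R/I` of the space of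
degree-`i` homogeneous forms. -/
def hilb (n : ℕ) (K : Type*) [Field K] (I : Ideal (MvPolynomial (Fin n) K)) (i : ℕ) : ℕ :=
  Module.finrank K
    ((homogeneousSubmodule (Fin n) K i).map (Ideal.Quotient.mkₐ K I).toLinearMap)

/-- The socle `(0 : A_+)` of `A = R/I`: the elements killed by (the images of)
all the variables, equivalently by the irrelevant maximal ideal. -/
def socleSub (n : ℕ) (K : Type*) [Field K] (I : Ideal (MvPolynomial (Fin n) K)) :
    Submodule K (MvPolynomial (Fin n) K ⧸ I) :=
  ⨅ k : Fin n, LinearMap.ker (LinearMap.mulLeft K (Ideal.Quotient.mk I (X k)))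

/-- A homogeneous (graded) ideal: one containing each homogeneous component of
each of its elements. -/
def IdealHomog {n : ℕ} {K : Type*} [Field K] (I : Ideal (MvPolynomial (Fin n) K)) : Prop :=
  ∀ f ∈ I, ∀ d : ℕ, homogeneousComponent d f ∈ I

/-- `R/I` is a graded Artinian Gorenstein quotient of `R = K[x_1,...,x_n]`
of socle degree `j`: `I` is homogeneous, `R/I` is finite dimensional over `K`
with 1-dimensional socle, and `j` is the top nonzero degree. -/
def IsAG (n : ℕ) (K : Type*) [Field K] (I : Ideal (MvPolynomial (Fin n) K)) (j : ℕ) : Prop :=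
  IdealHomog I ∧ FiniteDimensional K (MvPolynomial (Fin n) K ⧸ I) ∧
    Module.finrank K (socleSub n K I) = 1 ∧
    hilb n K I j ≠ 0 ∧ ∀ i, j < i → hilb n K I i = 0

/-- Macaulay's bound `c^{(d)}`: writing `c = C(k_d,d) + ... + C(k_1,1)` with
`k_d > k_d-1 > ... > k_1 ≥ 0` (the `d`-th Macaulay expansion, computed greedily),
`c^{(d)} = C(k_d+1,d+1) + ... + C(k_1+1,2)`; by convention `0^{(d)} = 0`. -/
def macB : ℕ → ℕ → ℕ
  | _, 0 => 0
  | c, (d+1) =>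
    if c = 0 then 0 else
      let k := Nat.findGreatest (fun k => Nat.choose k (d+1) ≤ c) (c + d + 1)
      Nat.choose (k+1) (d+2) + macB (c - Nat.choose k (d+1)) d

/-- `(t_0, ..., t_m)` is an O-sequence: `t_0 = 1` and `t_{i+1} ≤ t_i^{(i)}`
for `1 ≤ i ≤ m-1`. -/
def IsOSeq (t : ℕ → ℕ) (m : ℕ) : Prop :=
  t 0 = 1 ∧ ∀ i, 1 ≤ i → i + 1 ≤ m → t (i + 1) ≤ macB (t i) i

/-- `ΔH_{≤ m}` is an O-sequence: the first differences `ΔH_i = h_i - h_{i-1}`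
(with `ΔH_0 = 1`) are nonnegative for `i ≤ m`, and `(ΔH_0, ..., ΔH_m)` is an
O-sequence. -/
def DeltaOSeq (h : ℕ → ℕ) (m : ℕ) : Prop :=
  (∀ i, 1 ≤ i → i ≤ m → h (i - 1) ≤ h i) ∧
    IsOSeq (fun i => if i = 0 then 1 else h i - h (i - 1)) m

lemma choose_ge_aux (d c : ℕ) : c + 1 ≤ Nat.choose (c + d + 1) (d + 1) := by
  induction c with
  | zero => simp
  | succ c ih =>
    have h : Nat.choose (c + 1 + d + 1) (d + 1)
        = Nat.choose (c + d + 1) d + Nat.choose (c + d + 1) (d + 1) := by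
      rw [show c + 1 + d + 1 = (c + d + 1) + 1 by omega, Nat.choose_succ_succ']
    have : 0 < Nat.choose (c + d + 1) d := Nat.choose_pos (by omega)
    omega

lemma macB_zero (d : ℕ) : macB 0 d = 0 := by
  cases d <;> simp [macB]

lemma macB_eq (c d k : ℕ) (hc : c ≠ 0) (h1 : Nat.choose k (d + 1) ≤ c)
    (h2 : c < Nat.choose (k + 1) (d + 1)) :
    macB c (d + 1) = Nat.choose (k + 1) (d + 2) + macB (c - Nat.choose k (d + 1)) d := by
  have hk : Nat.findGreatest (fun k => Nat.choose k (d+1) ≤ c) (c + d + 1) = k := by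
    rw [Nat.findGreatest_eq_iff]
    refine ⟨?_, fun _ => h1, ?_⟩
    · by_contra hlt
      have := choose_ge_aux d c
      have h3 := Nat.choose_le_choose (d + 1) (show c + d + 1 ≤ k by omega)
      omega
    · intro m hm _ hmc
      have h3 := Nat.choose_le_choose (d + 1) (show k + 1 ≤ m by omega)
      omega
  rw [macB, if_neg hc]
  simp only [hk]

lemma exists_block (c d : ℕ) (hc : c ≠ 0) :
    ∃ k w, d + 1 ≤ k ∧ c = Nat.choose k (d + 1) + w ∧ w < Nat.choose k d := by
  let k := Nat.findGreatest (fun k => Nat.choose k (d+1) ≤ c) (c + d + 1)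
  have h0 : Nat.choose (d + 1) (d + 1) ≤ c := by simp; omega
  have hk1 : Nat.choose k (d + 1) ≤ c :=
    Nat.findGreatest_spec (P := fun k => Nat.choose k (d+1) ≤ c) (m := d + 1) (by omega) h0
  have hk2 : d + 1 ≤ k := Nat.le_findGreatest (by omega) h0
  have hk3 : c < Nat.choose (k + 1) (d + 1) := by
    by_contra hcon
    push Not at hcon
    by_cases hle : k + 1 ≤ c + d + 1
    · have : k + 1 ≤ k := Nat.le_findGreatest hle hcon
      omega
    · have := choose_ge_aux d c
      have h3 := Nat.choose_le_choose (d + 1) (show c + d + 1 ≤ k + 1 by omega)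
      omega
  refine ⟨k, c - Nat.choose k (d + 1), hk2, by omega, ?_⟩
  rw [Nat.choose_succ_succ'] at hk3
  omega

lemma macB_choose (k d : ℕ) (h : d ≤ k) :
    macB (Nat.choose k (d + 1)) (d + 1) = Nat.choose (k + 1) (d + 2) := by
  rcases Nat.eq_or_lt_of_le h with h | h
  · subst h
    simp [macB_zero]
  · have hp : 0 < Nat.choose k (d + 1) := Nat.choose_pos h
    have hp' : 0 < Nat.choose k d := Nat.choose_pos h.le
    rw [macB_eq _ d k (by omega) le_rfl (by rw [Nat.choose_succ_succ']; omega)]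
    simp [macB_zero]

lemma macB_one (c : ℕ) : macB c 1 = Nat.choose (c + 1) 2 := by
  simpa using macB_choose c 0 (Nat.zero_le _)

lemma macB_unit (d : ℕ) : macB 1 (d + 1) = 1 := by
  simpa using macB_choose (d + 1) d (by omega)

lemma macB_block (k e w : ℕ) (hk : e + 1 ≤ k) (hw : w ≤ Nat.choose k (e + 1)) :
    macB (Nat.choose k (e + 2) + w) (e + 2) = Nat.choose (k + 1) (e + 3) + macB w (e + 1) := by
  rcases Nat.eq_or_lt_of_le hw with h | h
  · have : Nat.choose k (e + 2) + w = Nat.choose (k + 1) (e + 2) := by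
      rw [Nat.choose_succ_succ' k (e+1)]; (try simp only [Nat.add_assoc, Nat.reduceAdd] at *); omega
    rw [this, macB_choose (k + 1) (e + 1) (by omega), h, macB_choose k e (by omega),
      Nat.choose_succ_succ' (k + 1) (e + 2)]
    (try simp only [Nat.add_assoc, Nat.reduceAdd] at *)
    omega
  · rcases Nat.eq_or_lt_of_le hk with h' | h'
    · subst h'
      have : w = 0 := by simpa using h
      subst this
      simp [macB_zero]
    · have hp : 0 < Nat.choose k (e + 2) := Nat.choose_pos h'
      rw [macB_eq _ (e + 1) k (by omega) (by (try simp only [Nat.add_assoc, Nat.reduceAdd] at *); omega)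
        (by rw [Nat.choose_succ_succ']; (try simp only [Nat.add_assoc, Nat.reduceAdd] at *); omega)]
      simp

lemma macB_strictMono (d : ℕ) : StrictMono (fun c => macB c (d + 1)) := by
  induction d with
  | zero =>
    refine strictMono_nat_of_lt_succ fun c => ?_
    simp only [zero_add, macB_one]
    rw [Nat.choose_succ_succ' (c + 1) 1]
    simp
  | succ d ih =>
    refine strictMono_nat_of_lt_succ fun c => ?_
    rcases Nat.eq_zero_or_pos c with h | h
    · subst h
      simp [macB_zero, macB_unit]
    · obtain ⟨k, w, hk, hc, hw⟩ := exists_block c (d + 1) (by omega)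
      subst hc
      have := ih (Nat.lt_succ_self w)
      simp only at this ⊢
      rw [macB_block k d w (by omega) hw.le, add_assoc, macB_block k d (w + 1) (by omega) hw]
      simpa using this

/-- `u ≤ u'^{(e)}`, with the right convention for `e = 0`. -/
def GG : ℕ → ℕ → ℕ → Prop
  | 0, u, u' => u = 0 ∨ 1 ≤ u'
  | (e+1), u, u' => u ≤ macB u' (e + 1)

lemma GG_key (e : ℕ) : ∀ u u', GG e u u' →
    macB (u - u') (e + 1) + u ≤ macB u (e + 1) ∧
      ∀ k, u ≤ Nat.choose k (e + 1) → u - u' ≤ Nat.choose (k - 1) (e + 1) := by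
  induction e with
  | zero =>
    intro u u' h
    rcases h with h | h
    · subst h; simp [macB_zero]
    · rcases Nat.eq_zero_or_pos u with h0 | h0
      · subst h0; simp [macB_zero]
      · obtain ⟨n, rfl⟩ : ∃ n, u = n + 1 := ⟨u - 1, by omega⟩
        constructor
        · have h1 := (macB_strictMono 0).monotone (show n + 1 - u' ≤ n by omega)
          simp only [zero_add, macB_one] at h1 ⊢
          rw [Nat.choose_succ_succ' (n + 1) 1]
          simp only [Nat.choose_one_right]
          (try simp only [Nat.add_assoc, Nat.reduceAdd] at *)
          omega
        · intro k hk
          simp only [zero_add, Nat.choose_one_right] at hk ⊢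
          (try simp only [Nat.add_assoc, Nat.reduceAdd] at *)
          omega
  | succ e ih =>
    intro u u' h
    have h : u ≤ macB u' (e + 1) := h
    rcases Nat.eq_zero_or_pos u with h0 | h0
    · subst h0; simp [macB_zero]
    obtain ⟨k, w, hk, hu, hw⟩ := exists_block u (e + 1) (by omega)
    obtain ⟨q, rfl⟩ : ∃ q, k = q + 1 := ⟨k - 1, by omega⟩
    have hpas : Nat.choose (q + 1) (e + 2) = Nat.choose q (e + 1) + Nat.choose q (e + 2) :=
      Nat.choose_succ_succ' _ _
    have hpas1 : Nat.choose (q + 1) (e + 1) = Nat.choose q e + Nat.choose q (e + 1) :=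
      Nat.choose_succ_succ' _ _
    have hpas2 : Nat.choose (q + 2) (e + 3) = Nat.choose (q + 1) (e + 2) + Nat.choose (q + 1) (e + 3) :=
      Nat.choose_succ_succ' _ _
    have hpos : 0 < Nat.choose q (e + 1) := Nat.choose_pos (by omega)
    have hu1 : Nat.choose q (e + 1) ≤ u' := by
      by_contra hcon
      have h1 := macB_strictMono e (not_le.mp hcon)
      simp only [macB_choose q e (by omega)] at h1
      (try simp only [Nat.add_assoc, Nat.reduceAdd] at *)
      omega
    obtain ⟨w', hw'1, hw'2, hw'3⟩ : ∃ w', Nat.choose q (e + 1) + w' ≤ u' ∧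
        w' ≤ Nat.choose q e ∧ GG e w w' := by
      refine ⟨min (u' - Nat.choose q (e + 1)) (Nat.choose q e), by omega, by omega, ?_⟩
      cases e with
      | zero =>
        simp only [GG]
        by_contra hcon
        push Not at hcon
        have h2 : u' = q := by
          have := hcon.2
          simp at this hu1
          (try simp only [Nat.add_assoc, Nat.reduceAdd] at *)
          omega
        subst h2
        simp only [zero_add, macB_one] at h hu
        (try simp only [Nat.add_assoc, Nat.reduceAdd] at *)
        omega
      | succ f =>
        simp only [GG]
        rcases le_total (Nat.choose q (f + 1)) (u' - Nat.choose q (f + 1 + 1)) with h3 | h3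
        · rw [min_eq_right h3, macB_choose q f (by omega)]
          exact hw.le
        · rw [min_eq_left h3]
          have h4 := macB_block q f (u' - Nat.choose q (f + 1 + 1)) (by omega) h3
          rw [show Nat.choose q (f + 2) + (u' - Nat.choose q (f + 1 + 1)) = u' by (try simp only [Nat.add_assoc, Nat.reduceAdd] at *); omega] at h4
          have h5 : u ≤ macB u' (f + 2) := h
          have h6 : u = Nat.choose (q + 1) (f + 3) + w := hu
          (try simp only [Nat.add_assoc, Nat.reduceAdd] at *)
          omega
    obtain ⟨ih1, ih2⟩ := ih w w' hw'3
    have ih2 := ih2 (q + 1) hw.le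
    rw [Nat.add_sub_cancel] at ih2
    have hsub : u - u' ≤ Nat.choose q (e + 2) + (w - w') := by
      have h6 : u = Nat.choose (q + 1) (e + 2) + w := hu
      (try simp only [Nat.add_assoc, Nat.reduceAdd] at *)
      omega
    have h6 : u = Nat.choose (q + 1) (e + 2) + w := hu
    constructor
    · have h1 := (macB_strictMono (e + 1)).monotone hsub
      beta_reduce at h1
      rw [macB_block q e (w - w') (by omega) ih2] at h1
      have h2 := macB_block (q + 1) e w (by omega) hw.le
      rw [← h6] at h2
      show macB (u - u') (e + 2) + u ≤ macB u (e + 2)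
      rw [h2]
      have h1 : macB (u - u') (e + 2) ≤ Nat.choose (q + 1) (e + 3) + macB (w - w') (e + 1) := h1
      have h7 : Nat.choose (q + 1 + 1) (e + 3) = Nat.choose (q + 1) (e + 2) + Nat.choose (q + 1) (e + 3) := hpas2
      (try simp only [Nat.add_assoc, Nat.reduceAdd] at *)
      omega
    · intro K hK
      have hK : u ≤ Nat.choose K (e + 2) := hK
      show u - u' ≤ Nat.choose (K - 1) (e + 2)
      rcases Nat.lt_or_ge (q + 1) K with h8 | h8
      · have := Nat.choose_le_choose (e + 2) (show q + 1 ≤ K - 1 by omega)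
        (try simp only [Nat.add_assoc, Nat.reduceAdd] at *)
        omega
      · have h9 := Nat.choose_le_choose (e + 2) h8
        have hw0 : w = 0 := by omega
        rcases Nat.lt_or_ge q K with h10 | h10
        · have : K - 1 = q := by omega
          rw [this]; omega
        · have := Nat.choose_le_choose (e + 2) h10
          (try simp only [Nat.add_assoc, Nat.reduceAdd] at *)
          omega


/-- Dimension of the image of `U` in the quotient by `W`. -/
def dq {K B : Type*} [Field K] [AddCommGroup B] [Module K B] (W U : Submodule K B) : ℕ :=
  Module.finrank K (U.map W.mkQ)

section LinAlg

variable {K : Type*} [Field K] {B : Type*} [AddCommGroup B] [Module K B]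

lemma finrank_map_add [FiniteDimensional K B] {N : Type*} [AddCommGroup N] [Module K N]
    (f : B →ₗ[K] N) (U : Submodule K B) :
    Module.finrank K (U.map f) + Module.finrank K (U ⊓ LinearMap.ker f : Submodule K B)
      = Module.finrank K U := by
  have h := LinearMap.finrank_range_add_finrank_ker (f.domRestrict U)
  have h1 : LinearMap.range (f.domRestrict U) = U.map f := by
    ext y; simp
  have h2 : Module.finrank K (LinearMap.ker (f.domRestrict U))
      = Module.finrank K (U ⊓ LinearMap.ker f : Submodule K B) := by
    rw [LinearMap.ker_domRestrict, ← Submodule.map_comap_subtype,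
      Submodule.finrank_map_subtype_eq]
  rw [h1, h2] at h
  exact h

lemma dq_add_inf [FiniteDimensional K B] (W U : Submodule K B) :
    dq W U + Module.finrank K (U ⊓ W : Submodule K B) = Module.finrank K U := by
  have := finrank_map_add W.mkQ U
  rwa [Submodule.ker_mkQ] at this

lemma dq_add [FiniteDimensional K B] (W U : Submodule K B) :
    dq W U + Module.finrank K W = Module.finrank K (W ⊔ U : Submodule K B) := by
  have h1 := dq_add_inf W U
  have h2 := Submodule.finrank_sup_add_finrank_inf_eq U W
  rw [sup_comm] at h2
  omega

lemma dq_sup [FiniteDimensional K B] (W U U' : Submodule K B) :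
    dq W (U' ⊔ U) = dq W U' + dq (W ⊔ U') U := by
  have h1 := dq_add W (U' ⊔ U)
  have h2 := dq_add W U'
  have h3 := dq_add (W ⊔ U') U
  rw [sup_assoc] at h3
  omega

lemma dq_anti [FiniteDimensional K B] {W W' : Submodule K B} (h : W ≤ W') (U : Submodule K B) :
    dq W' U ≤ dq W U := by
  have h1 := dq_add_inf W U
  have h2 := dq_add_inf W' U
  have h3 := Submodule.finrank_mono (inf_le_inf_left U h)
  omega

lemma dq_mono [FiniteDimensional K B] (W : Submodule K B) {U U' : Submodule K B} (h : U ≤ U') :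
    dq W U ≤ dq W U' :=
  Submodule.finrank_mono (Submodule.map_mono h)

lemma dq_map [FiniteDimensional K B] (f : B →ₗ[K] B) (W U : Submodule K B) :
    dq W (U.map f) = dq (W.comap f) U := by
  have h1 := finrank_map_add (W.mkQ ∘ₗ f) U
  have h2 := dq_add_inf (W.comap f) U
  rw [LinearMap.ker_comp, Submodule.ker_mkQ, Submodule.map_comp] at h1
  simp only [dq] at *
  omega

lemma dq_eq_zero [FiniteDimensional K B] {W U : Submodule K B} (h : dq W U = 0) : U ≤ W := by
  have h1 := dq_add_inf W U
  have h2 : U ⊓ W = U := Submodule.eq_of_le_of_finrank_eq inf_le_left (by omega)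
  exact inf_eq_left.mp h2

lemma dq_zero_of_le [FiniteDimensional K B] {W U : Submodule K B} (h : U ≤ W) : dq W U = 0 := by
  have h1 := dq_add_inf W U
  rw [inf_eq_left.mpr h] at h1
  omega

lemma rank_line {M N : Type*} [AddCommGroup M] [Module K M] [FiniteDimensional K M]
    [AddCommGroup N] [Module K N] (f0 f1 : M →ₗ[K] N) (t : ℕ)
    (h : t ≤ Module.finrank K (LinearMap.range f0)) :
    {s : K | ¬ t ≤ Module.finrank K (LinearMap.range (f0 + s • f1))}.Finite := by
  obtain ⟨b, hb⟩ := exists_linearIndependent_of_le_finrank h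
  choose a ha using fun i => (b i).2
  have hb' : LinearIndependent K (fun i => f0 (a i)) := by
    have := hb.map' (LinearMap.range f0).subtype (Submodule.ker_subtype _)
    have h2 : (fun i => f0 (a i)) = (LinearMap.range f0).subtype ∘ b := funext ha
    rw [h2]
    exact this
  let A : (Fin t → K) →ₗ[K] M := Fintype.linearCombination K a
  have hinj : LinearMap.ker (f0 ∘ₗ A) = ⊥ := by
    have : f0 ∘ₗ A = Fintype.linearCombination K (fun i => f0 (a i)) := by
      ext i; simp [A, Fintype.linearCombination_apply_single]
    rw [this, LinearMap.ker_eq_bot]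
    exact hb'.fintypeLinearCombination_injective
  obtain ⟨φ, hφ⟩ := LinearMap.exists_leftInverse_of_injective _ hinj
  let T : Module.End K (Fin t → K) := φ ∘ₗ f1 ∘ₗ A
  have hfin : {μ : K | T.HasEigenvalue μ}.Finite := by
    exact Module.End.finite_hasEigenvalue T
  refine (hfin.preimage (f := fun s : K => -s⁻¹) ?_).subset ?_
  · intro s _ s' _ h
    simpa using h
  intro s hs
  by_contra hcon
  apply hs
  have hinj2 : Function.Injective (φ ∘ₗ (f0 + s • f1) ∘ₗ A) := by
    rw [← LinearMap.ker_eq_bot, Submodule.eq_bot_iff]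
    intro y hy
    by_contra hy0
    have hy1 : y + s • T y = 0 := by
      have h1 := LinearMap.congr_fun hφ y
      have h2 : φ ((f0 + s • f1) (A y)) = 0 := hy
      have h1 : φ (f0 (A y)) = y := h1
      rw [LinearMap.add_apply, LinearMap.smul_apply, map_add, map_smul, h1] at h2
      exact h2
    have hs0 : s ≠ 0 := by
      rintro rfl
      simp at hy1
      exact hy0 hy1
    apply hcon
    refine Module.End.hasEigenvalue_of_hasEigenvector (x := y) ⟨?_, hy0⟩
    rw [Module.End.mem_eigenspace_iff]
    have h3 : s • T y = -y := by
      rw [eq_neg_iff_add_eq_zero, add_comm]; exact hy1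
    calc T y = s⁻¹ • (s • T y) := by rw [smul_smul, inv_mul_cancel₀ hs0, one_smul]
      _ = -s⁻¹ • y := by rw [h3]; simp
  have h4 := LinearMap.finrank_range_of_inj hinj2
  rw [Module.finrank_fin_fun] at h4
  have h5 : LinearMap.range (φ ∘ₗ (f0 + s • f1) ∘ₗ A)
      ≤ (LinearMap.range (f0 + s • f1)).map φ := by
    rintro _ ⟨y, rfl⟩
    exact ⟨(f0 + s • f1) (A y), ⟨_, rfl⟩, rfl⟩
  have h6 := Submodule.finrank_mono h5
  have h7 := Submodule.finrank_map_le φ (LinearMap.range (f0 + s • f1))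
  omega

/-- A condition which, on each line through a point satisfying it, fails finitely often. -/
def LineOpen {V : Type*} [AddCommGroup V] [Module K V] (P : V → Prop) : Prop :=
  ∀ a b, P a → {s : K | ¬ P (a + s • (b - a))}.Finite

variable {V : Type*} [AddCommGroup V] [Module K V]

lemma LineOpen.exists_both [Infinite K] {P Q : V → Prop} (hP : LineOpen (K := K) P)
    (hQ : LineOpen (K := K) Q) {a b : V} (ha : P a) (hb : Q b) : ∃ v, P v ∧ Q v := by
  have h1 := hP a b ha
  have h2 := (hQ b a hb).preimage (f := fun s : K => 1 - s) (by
    intro s _ s' _ h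
    simpa using h)
  obtain ⟨s, hs⟩ := (h1.union h2).infinite_compl.nonempty
  simp only [Set.mem_compl_iff, Set.mem_union, Set.mem_preimage, Set.mem_ofPred_eq, not_or,
    not_not] at hs
  refine ⟨_, hs.1, ?_⟩
  convert hs.2 using 1
  module

lemma LineOpen.and {P Q : V → Prop} (hP : LineOpen (K := K) P)
    (hQ : LineOpen (K := K) Q) : LineOpen (K := K) (fun v => P v ∧ Q v) := by
  intro a b h
  refine ((hP a b h.1).union (hQ a b h.2)).subset ?_
  intro s hs
  simp only [Set.mem_ofPred_eq, Set.mem_union] at *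
  tauto

lemma lineOpen_affine {M N : Type*} [AddCommGroup M] [Module K M] [FiniteDimensional K M]
    [AddCommGroup N] [Module K N] (F : V → (M →ₗ[K] N)) (t : ℕ)
    (hF : ∀ a b (s : K), F (a + s • (b - a)) = F a + s • (F b - F a)) :
    LineOpen (K := K) (fun v => t ≤ Module.finrank K (LinearMap.range (F v))) := by
  intro a b h
  refine (rank_line (F a) (F b - F a) t h).subset ?_
  intro s hs
  have hs : ¬ t ≤ Module.finrank K (LinearMap.range (F (a + s • (b - a)))) := hs
  rw [hF] at hs
  exact hs

end LinAlg

section Green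

variable {K : Type*} [Field K] {B : Type*} [CommRing B] [Algebra K B] {n : ℕ}

/-- Multiplication by the linear form with coefficients `v`. -/
def mulL (x : Fin n → B) (v : Fin n → K) : B →ₗ[K] B := LinearMap.mulLeft K (∑ k, v k • x k)

lemma mulL_apply (x : Fin n → B) (v : Fin n → K) (b : B) :
    mulL x v b = (∑ k, v k • x k) * b := rfl

lemma mulL_affine (x : Fin n → B) (a b : Fin n → K) (s : K) :
    mulL x (a + s • (b - a)) = mulL x a + s • (mulL x b - mulL x a) := by
  ext y
  simp only [mulL_apply, LinearMap.add_apply, LinearMap.smul_apply, LinearMap.sub_apply,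
    Pi.add_apply, Pi.smul_apply, Pi.sub_apply, add_smul, Finset.sum_add_distrib, smul_assoc,
    sub_smul, ← Finset.smul_sum, Finset.sum_sub_distrib, add_mul, sub_mul, smul_mul_assoc]

lemma lineOpen_one [FiniteDimensional K B] (x : Fin n → B) (W U : Submodule K B) (t : ℕ) :
    LineOpen (K := K) (fun v : Fin n → K => t ≤ dq W (U.map (mulL x v))) := by
  have := lineOpen_affine (K := K) (fun v : Fin n → K => W.mkQ ∘ₗ mulL x v ∘ₗ U.subtype) t (by
    intro a b s
    ext y
    simp [mulL_affine])
  convert this using 5 with v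
  rw [LinearMap.range_comp, LinearMap.range_comp, Submodule.range_subtype]
  rfl

lemma lineOpen_two [FiniteDimensional K B] (x : Fin n → B) (W U U' : Submodule K B) (t : ℕ) :
    LineOpen (K := K) (fun v : Fin n → K => t ≤ dq W (U' ⊔ U.map (mulL x v))) := by
  have := lineOpen_affine (K := K) (fun v : Fin n → K =>
    (W.mkQ ∘ₗ U'.subtype).coprod (W.mkQ ∘ₗ mulL x v ∘ₗ U.subtype)) t (by
    intro a b s
    ext y <;> simp [mulL_affine])
  convert this using 5 with v
  rw [LinearMap.range_coprod, LinearMap.range_comp, LinearMap.range_comp, LinearMap.range_comp,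
    Submodule.range_subtype, Submodule.range_subtype, ← Submodule.map_sup]
  rfl

lemma mulL_single (x : Fin n → B) (k : Fin n) :
    mulL x (Pi.single k (1 : K)) = LinearMap.mulLeft K (x k) := by
  unfold mulL
  congr 1
  rw [Finset.sum_eq_single k] <;> simp +contextual

lemma map_mulL_le (x : Fin n → B) (S : ℕ → Submodule K B)
    (hS : ∀ i, S (i + 1) = ⨆ k, (S i).map (LinearMap.mulLeft K (x k))) (v : Fin n → K) (i : ℕ) :
    (S i).map (mulL x v) ≤ S (i + 1) := by
  rintro _ ⟨y, hy, rfl⟩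
  rw [mulL_apply, Finset.sum_mul]
  refine Submodule.sum_mem _ fun k _ => ?_
  rw [smul_mul_assoc]
  refine Submodule.smul_mem _ _ ?_
  rw [hS]
  exact Submodule.mem_iSup_of_mem k ⟨y, hy, rfl⟩

/-- A form of Green's hyperplane restriction theorem. -/
theorem green [Infinite K] [FiniteDimensional K B] (x : Fin n → B) (S : ℕ → Submodule K B)
    (hS : ∀ i, S (i + 1) = ⨆ k, (S i).map (LinearMap.mulLeft K (x k))) (e : ℕ) :
    ∀ c (W : Submodule K B), dq W (S (e + 1)) = c →
      ∃ v : Fin n → K, GG e c (dq W ((S e).map (mulL x v))) := by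
  induction e with
  | zero =>
    intro c W hc
    by_cases h0 : c = 0
    · exact ⟨0, Or.inl h0⟩
    have : ∃ k, ¬ (S 0).map (LinearMap.mulLeft K (x k)) ≤ W := by
      by_contra hcon
      push Not at hcon
      apply h0
      rw [← hc]
      apply dq_zero_of_le
      rw [hS]
      exact iSup_le hcon
    obtain ⟨k, hk⟩ := this
    refine ⟨Pi.single k 1, Or.inr ?_⟩
    rw [mulL_single]
    by_contra hlt
    exact hk (dq_eq_zero (by omega))
  | succ e ihe =>
    intro c
    induction c using Nat.strong_induction_on with
    | _ c ihc =>
    intro W hc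
    by_cases h0 : c = 0
    · exact ⟨0, by subst h0; exact Nat.zero_le _⟩
    obtain ⟨k, hk⟩ : ∃ k, ¬ (S (e + 1)).map (LinearMap.mulLeft K (x k)) ≤ W := by
      by_contra hcon
      push Not at hcon
      apply h0
      rw [← hc]
      apply dq_zero_of_le
      rw [hS]
      exact iSup_le hcon
    obtain ⟨v1, hv1⟩ : ∃ v1 : Fin n → K, ∀ v : Fin n → K,
        dq W ((S (e + 1)).map (mulL x v)) ≤ dq W ((S (e + 1)).map (mulL x v1)) := by
      have hfin : (Set.range fun v : Fin n → K => dq W ((S (e + 1)).map (mulL x v))).Finite := by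
        refine (Set.finite_Iic c).subset ?_
        rintro _ ⟨v, rfl⟩
        simp only [Set.mem_Iic]
        rw [← hc]
        exact dq_mono W (map_mulL_le x S hS v (e + 1))
      obtain ⟨_, ⟨v1, rfl⟩, h⟩ := Set.exists_max_image _ id hfin ⟨_, ⟨0, rfl⟩⟩
      exact ⟨v1, fun v => h _ ⟨v, rfl⟩⟩
    set u := dq W ((S (e + 1)).map (mulL x v1)) with hu
    have hu1 : 1 ≤ u := by
      have h1 := hv1 (Pi.single k 1)
      rw [mulL_single] at h1
      by_contra hlt
      exact hk (dq_eq_zero (by omega))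
    have hsplit : ∀ v : Fin n → K, c = dq W ((S (e + 1)).map (mulL x v)) +
        dq (W ⊔ (S (e + 1)).map (mulL x v)) (S (e + 2)) := by
      intro v
      rw [← dq_sup, sup_eq_right.mpr (map_mulL_le x S hS v (e + 1)), ← hc]
    obtain ⟨v1', hv1'⟩ := ihc (c - u) (by omega) (W ⊔ (S (e + 1)).map (mulL x v1))
      (by have := hsplit v1; simp only [Nat.add_assoc, Nat.reduceAdd] at *; omega)
    set y := dq (W ⊔ (S (e + 1)).map (mulL x v1)) ((S (e + 1)).map (mulL x v1')) with hy
    have hv1' : c - u ≤ macB y (e + 1) := hv1'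
    have hT1 : u + y ≤ dq W ((S (e + 1)).map (mulL x v1) ⊔ (S (e + 1)).map (mulL x v1')) := by
      rw [dq_sup]
    obtain ⟨v', hv'1, hv'2⟩ := (lineOpen_two x W (S (e + 1)) ((S (e + 1)).map (mulL x v1))
      (u + y)).exists_both (lineOpen_one x W (S (e + 1)) u) hT1 hu.le
    have hv'3 : dq W ((S (e + 1)).map (mulL x v')) = u := le_antisymm (hv1 v') hv'2
    rw [sup_comm] at hv'1
    have hq : dq (W.comap (mulL x v')) (S (e + 1)) = u := by rw [← dq_map, hv'3]
    obtain ⟨v2, hv2⟩ := ihe u _ hq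
    obtain ⟨v3, hv3⟩ := (lineOpen_two x W (S (e + 1)) ((S (e + 1)).map (mulL x v'))
      (u + y)).exists_both (lineOpen_one x W (S (e + 1)) u) hv'1 hu.le
    obtain ⟨v, ⟨hva, hvb⟩, hvc⟩ := ((lineOpen_two x W (S (e + 1)) ((S (e + 1)).map (mulL x v'))
      (u + y)).and (lineOpen_one x W (S (e + 1)) u)).exists_both
      (lineOpen_one x (W.comap (mulL x v')) (S e)
        (dq (W.comap (mulL x v')) ((S e).map (mulL x v2)))) hv3 le_rfl
    have hvd : dq W ((S (e + 1)).map (mulL x v)) = u := le_antisymm (hv1 v) hvb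
    rw [sup_comm, dq_sup, hvd, dq_map] at hva
    set u' := dq (W.comap (mulL x v')) ((S e).map (mulL x v2)) with hu'
    have hs2 : dq (W.comap (mulL x v')) (S (e + 1)) =
        dq (W.comap (mulL x v')) ((S e).map (mulL x v)) +
        dq (W.comap (mulL x v') ⊔ (S e).map (mulL x v)) (S (e + 1)) := by
      rw [← dq_sup, sup_eq_right.mpr (map_mulL_le x S hS v e)]
    have hle : W.comap (mulL x v') ⊔ (S e).map (mulL x v) ≤
        (W ⊔ (S (e + 1)).map (mulL x v)).comap (mulL x v') := by
      refine sup_le (Submodule.comap_mono le_sup_left) ?_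
      rintro _ ⟨z, hz, rfl⟩
      refine Submodule.mem_comap.mpr (Submodule.mem_sup_right ⟨mulL x v' z, ?_, ?_⟩)
      · exact map_mulL_le x S hS v' e ⟨z, hz, rfl⟩
      · simp only [mulL_apply]; ring
    have hs3 := dq_anti hle (S (e + 1))
    have hyu : y ≤ u - u' := by omega
    obtain ⟨hkey, -⟩ := GG_key e u u' hv2
    have hm := (macB_strictMono e).monotone hyu
    beta_reduce at hm
    refine ⟨v1, ?_⟩
    show c ≤ macB u (e + 1)
    have hs4 := hsplit v1
    omega

end Green

lemma homog_succ (n : ℕ) (K : Type*) [Field K] (i : ℕ) :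
    homogeneousSubmodule (Fin n) K (i + 1)
      = ⨆ k, (homogeneousSubmodule (Fin n) K i).map (LinearMap.mulLeft K (X k)) := by
  apply le_antisymm
  · intro f hf
    have hf : f.IsHomogeneous (i + 1) := hf
    rw [f.as_sum]
    refine Submodule.sum_mem _ fun m hm => ?_
    have hdeg : m.degree = i + 1 := by
      rw [Finsupp.degree_eq_weight_one]
      exact hf (mem_support_iff.mp hm)
    obtain ⟨k, hk⟩ : ∃ k, m k ≠ 0 := by
      by_contra hcon
      push Not at hcon
      have : m = 0 := Finsupp.ext hcon
      rw [this] at hdeg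
      simp at hdeg
    have hle : Finsupp.single k 1 ≤ m := by
      rw [Finsupp.single_le_iff]; omega
    refine Submodule.mem_iSup_of_mem k ⟨monomial (m - Finsupp.single k 1) (coeff m f), ?_, ?_⟩
    · refine isHomogeneous_monomial _ ?_
      have h2 : (m - Finsupp.single k 1 + Finsupp.single k 1).degree = i + 1 := by
        rw [tsub_add_cancel_of_le hle, hdeg]
      rw [map_add, Finsupp.degree_single] at h2
      omega
    · rw [LinearMap.mulLeft_apply, X, monomial_mul, add_tsub_cancel_of_le hle, one_mul]
  · refine iSup_le fun k => ?_
    rintro _ ⟨f, hf, rfl⟩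
    have hf : f.IsHomogeneous i := hf
    rw [LinearMap.mulLeft_apply, add_comm]
    exact (isHomogeneous_X K k).mul hf

lemma img_succ (n : ℕ) (K : Type*) [Field K] (I : Ideal (MvPolynomial (Fin n) K)) (i : ℕ) :
    (homogeneousSubmodule (Fin n) K (i + 1)).map (Ideal.Quotient.mkₐ K I).toLinearMap
      = ⨆ k, ((homogeneousSubmodule (Fin n) K i).map (Ideal.Quotient.mkₐ K I).toLinearMap).map
          (LinearMap.mulLeft K (Ideal.Quotient.mk I (X k))) := by
  rw [homog_succ, Submodule.map_iSup]
  refine iSup_congr fun k => ?_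
  rw [← Submodule.map_comp, ← Submodule.map_comp]
  congr 1

lemma dq_bot {K B : Type*} [Field K] [AddCommGroup B] [Module K B] [FiniteDimensional K B]
    (U : Submodule K B) : dq ⊥ U = Module.finrank K U := by
  have := dq_add_inf ⊥ U
  rwa [inf_bot_eq, finrank_bot, add_zero] at this

/-- If the Hilbert function `H` of a graded Artinian Gorenstein
quotient of `K[x_1,...,x_r]` of socle degree `j` has extremal growth
`h_{d+1} = (h_d)^{(d)}` for some `d < j`, then the first-difference sequence
`(Δh_0, ..., Δh_{d+1})` is nonnegative and is an O-sequence. -/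
theorem statement_1 {K : Type*} [Field K] [IsAlgClosed K] [CharZero K]
    (r j d : ℕ) (I : Ideal (MvPolynomial (Fin r) K))
    (hI : IsAG r K I j) (hdj : d < j)
    (hext : hilb r K I (d + 1) = macB (hilb r K I d) d) :
    DeltaOSeq (hilb r K I) (d + 1) := by
  obtain ⟨hhom, hfd, hsoc, hj, hbig⟩ := hI
  have hinf : Infinite K := inferInstance
  set S : ℕ → Submodule K (MvPolynomial (Fin r) K ⧸ I) := fun i =>
    (homogeneousSubmodule (Fin r) K i).map (Ideal.Quotient.mkₐ K I).toLinearMap with hSdef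
  have hil : ∀ i, hilb r K I i = Module.finrank K (S i) := fun i => rfl
  set x : Fin r → (MvPolynomial (Fin r) K ⧸ I) := fun k => Ideal.Quotient.mk I (X k) with hx
  have hS : ∀ i, S (i + 1) = ⨆ k, (S i).map (LinearMap.mulLeft K (x k)) := img_succ r K I
  have hxS : ∀ i k f, f ∈ S i → x k * f ∈ S (i + 1) := by
    intro i k f hf
    rw [hS]
    exact Submodule.mem_iSup_of_mem k ⟨f, hf, rfl⟩
  -- the socle is `S j`
  have hsj : S j = socleSub r K I := by
    refine Submodule.eq_of_le_of_finrank_le ?_ ?_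
    · intro f hf
      simp only [socleSub, Submodule.mem_iInf, LinearMap.mem_ker, LinearMap.mulLeft_apply]
      intro k
      have h1 := hxS j k f hf
      have h2 : S (j + 1) = ⊥ := Submodule.finrank_eq_zero.mp (hbig (j + 1) (by omega))
      rw [h2] at h1
      exact (Submodule.mem_bot K).mp h1
    · rw [hsoc]
      exact Nat.one_le_iff_ne_zero.mpr hj
  have hker : ∀ i, i < j → ∀ f ∈ S i, (∀ k, x k * f = 0) → f = 0 := by
    intro i hi f hf hk
    have hfj : f ∈ S j := by
      rw [hsj]
      simp only [socleSub, Submodule.mem_iInf, LinearMap.mem_ker, LinearMap.mulLeft_apply]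
      exact hk
    obtain ⟨p, hp, rfl⟩ := hf
    obtain ⟨q, hq, hqp⟩ := hfj
    have hp : p.IsHomogeneous i := hp
    have hq : q.IsHomogeneous j := hq
    have hmem : p - q ∈ I := by
      rw [← Ideal.Quotient.eq]
      exact hqp.symm
    have h1 := hhom _ hmem i
    rw [map_sub, homogeneousComponent_of_mem hp, homogeneousComponent_of_mem hq, if_pos rfl,
      if_neg (by omega), sub_zero] at h1
    exact Ideal.Quotient.eq_zero_iff_mem.mpr h1
  -- the degenerate case
  rcases Nat.eq_zero_or_pos d with hd0 | hd0
  · exfalso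
    subst hd0
    have h1 : hilb r K I 1 = 0 := by rw [hext]; rfl
    have h2 : ∀ i, S (i + 1) = ⊥ := by
      intro i
      induction i with
      | zero => exact Submodule.finrank_eq_zero.mp h1
      | succ i ih => rw [hS, ih]; simp
    apply hj
    obtain ⟨i, rfl⟩ : ∃ i, j = i + 1 := ⟨j - 1, by omega⟩
    rw [hil, h2]
    simp
  obtain ⟨e, rfl⟩ : ∃ e, d = e + 1 := ⟨d - 1, by omega⟩
  -- the general linear form
  obtain ⟨v, hv⟩ := green x S hS (e + 1) _ ⊥ rfl
  have hv : dq ⊥ (S (e + 2)) ≤ macB (dq ⊥ ((S (e + 1)).map (mulL x v))) (e + 1) := hv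
  rw [dq_bot, dq_bot] at hv
  have hv2 : macB (Module.finrank K (S (e + 1))) (e + 1)
      ≤ macB (Module.finrank K ((S (e + 1)).map (mulL x v))) (e + 1) :=
    le_trans (le_of_eq hext.symm) hv
  have hv3 := (macB_strictMono e).le_iff_le.mp hv2
  have hinj : ∀ i, i ≤ e + 1 → ∀ f ∈ S i, mulL x v f = 0 → f = 0 := by
    intro i hi
    induction hi using Nat.decreasingInduction with
    | self =>
      intro f hf h0
      have h1 := finrank_map_add (mulL x v) (S (e + 1))
      have h2 : (S (e + 1) ⊓ LinearMap.ker (mulL x v) :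
          Submodule K (MvPolynomial (Fin r) K ⧸ I)) = ⊥ :=
        Submodule.finrank_eq_zero.mp (by omega)
      have h3 : f ∈ S (e + 1) ⊓ LinearMap.ker (mulL x v) := ⟨hf, h0⟩
      rw [h2] at h3
      exact (Submodule.mem_bot K).mp h3
    | of_succ i hi ih =>
      intro f hf h0
      refine hker i (by omega) f hf fun k => ih _ (hxS i k f hf) ?_
      rw [mulL_apply] at h0 ⊢
      rw [mul_left_comm, h0, mul_zero]
  have hrk : ∀ i, i ≤ e + 1 → Module.finrank K ((S i).map (mulL x v))
      = Module.finrank K (S i) := by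
    intro i hi
    have h1 := finrank_map_add (mulL x v) (S i)
    have h2 : (S i ⊓ LinearMap.ker (mulL x v) :
        Submodule K (MvPolynomial (Fin r) K ⧸ I)) = ⊥ := by
      rw [Submodule.eq_bot_iff]
      rintro f ⟨hf, h0⟩
      exact hinj i hi f hf h0
    rw [h2, finrank_bot] at h1
    omega
  have hmono : ∀ i, i ≤ e + 1 → hilb r K I i ≤ hilb r K I (i + 1) := by
    intro i hi
    rw [hil, hil, ← hrk i hi]
    exact Submodule.finrank_mono (map_mulL_le x S hS v i)
  have hdelta : ∀ i, i ≤ e + 1 → dq ((S i).map (mulL x v)) (S (i + 1))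
      = hilb r K I (i + 1) - hilb r K I i := by
    intro i hi
    have h1 := dq_add_inf ((S i).map (mulL x v)) (S (i + 1))
    rw [inf_eq_right.mpr (map_mulL_le x S hS v i), hrk i hi] at h1
    rw [hil, hil]
    omega
  refine ⟨?_, if_pos rfl, ?_⟩
  · intro i h1 h2
    obtain ⟨m, rfl⟩ : ∃ m, i = m + 1 := ⟨i - 1, by omega⟩
    exact hmono m (by omega)
  · intro i h1 h2
    obtain ⟨m, rfl⟩ : ∃ m, i = m + 1 := ⟨i - 1, by omega⟩
    simp only [Nat.add_eq_zero_iff, one_ne_zero, and_false, if_false, Nat.add_sub_cancel]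
    rw [← hdelta m (by omega), ← hdelta (m + 1) (by omega)]
    obtain ⟨v', hv'⟩ := green x S hS (m + 1) _ ((S (m + 1)).map (mulL x v)) rfl
    refine le_trans hv' ((macB_strictMono m).monotone ?_)
    rw [dq_map]
    refine dq_anti ?_ _
    rintro _ ⟨z, hz, rfl⟩
    refine Submodule.mem_comap.mpr ⟨mulL x v' z, ?_, ?_⟩
    · exact map_mulL_le x S hS v' m ⟨z, hz, rfl⟩
    · simp only [mulL_apply]; ring

end
end

section
/- For an integer h, the sequence H = (1,4,7,h,7,4,1) is the Hilbert function of some graded Artinian Gorenstein quotient of R = K[w,x,y,z] if and only if 7 ≤ h ≤ 11. -/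
open MvPolynomial

noncomputable section

section Std
open Classical in
theorem finrank_span_greedy {K V : Type*} [Field K] [AddCommGroup V] [Module K V]
    [FiniteDimensional K V] (v : ℕ → V) (s : Finset ℕ) :
    Module.finrank K (Submodule.span K (v '' s)) =
      (s.filter (fun a => v a ∉ Submodule.span K (v '' {b | b ∈ s ∧ b < a}))).card := by
  induction s using Finset.induction_on_max with
  | empty => simp
  | insert a s ha ih =>
    have has : a ∉ s := fun h => lt_irrefl _ (ha a h)
    have h1 : {b | b ∈ insert a s ∧ b < a} = (s : Set ℕ) := by
      ext b
      simp only [Finset.mem_insert, Set.mem_ofPred_eq, Finset.mem_coe]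
      constructor
      · rintro ⟨rfl | h, h2⟩
        · exact absurd h2 (lt_irrefl _)
        · exact h
      · intro h
        exact ⟨Or.inr h, ha b h⟩
    have h2 : ∀ c ∈ s, {b | b ∈ insert a s ∧ b < c} = {b | b ∈ s ∧ b < c} := by
      intro c hc
      ext b
      simp only [Finset.mem_insert, Set.mem_ofPred_eq]
      constructor
      · rintro ⟨rfl | h, h2⟩
        · exact absurd (h2.trans (ha c hc)) (lt_irrefl _)
        · exact ⟨h, h2⟩
      · rintro ⟨h, h'⟩
        exact ⟨Or.inr h, h'⟩
    have h3 : s.filter (fun c => v c ∉ Submodule.span K (v '' {b | b ∈ insert a s ∧ b < c})) =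
        s.filter (fun c => v c ∉ Submodule.span K (v '' {b | b ∈ s ∧ b < c})) := by
      apply Finset.filter_congr
      intro c hc
      rw [h2 c hc]
    have h4 : Submodule.span K (v '' ((insert a s : Finset ℕ) : Set ℕ)) =
        Submodule.span K (v '' s) ⊔ Submodule.span K {v a} := by
      rw [Finset.coe_insert, Set.image_insert_eq, Submodule.span_insert, sup_comm]
    rw [Finset.filter_insert, h1, h3, h4]
    by_cases hv : v a ∈ Submodule.span K (v '' s)
    · rw [if_neg (by simpa using hv), ← ih]
      rw [sup_eq_left.2 ((Submodule.span_singleton_le_iff_mem _ _).2 hv)]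
    · rw [if_pos hv, Finset.card_insert_of_notMem, Submodule.finrank_sup_span_singleton hv, ih]
      intro h
      exact has (Finset.mem_filter.1 h).1

def LL (d : ℕ) : Finset ℕ := (Finset.range 4096).filter
  (fun c => c % 8 + c / 8 % 8 + c / 8 / 8 % 8 + c / 8 / 8 / 8 = d)

/-- The exponent with base-8 code `c`. -/
def decE (c : ℕ) : Fin 4 →₀ ℕ := Finsupp.equivFunOnFinite.symm ![c % 8, c / 8 % 8, c / 8 / 8 % 8, c / 8 / 8 / 8]

def encE (m : Fin 4 →₀ ℕ) : ℕ := m 0 + 8 * m 1 + 64 * m 2 + 512 * m 3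

def PP : Fin 4 → ℕ := ![1, 8, 64, 512]

theorem degree_four (m : Fin 4 →₀ ℕ) : m.degree = m 0 + m 1 + m 2 + m 3 := by
  rw [Finsupp.degree_eq_sum, Fin.sum_univ_four]

theorem digits8 (n a b c d : ℕ) (ha : a < 8) (hb : b < 8) (hc : c < 8)
    (h : n = a + 8 * b + 64 * c + 512 * d) :
    n % 8 = a ∧ n / 8 % 8 = b ∧ n / 8 / 8 % 8 = c ∧ n / 8 / 8 / 8 = d := by
  have h1 : n / 8 = b + 8 * c + 64 * d := by omega
  have h2 : n / 8 / 8 = c + 8 * d := by omega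
  refine ⟨by omega, by omega, by omega, by omega⟩

theorem decE_encE (m : Fin 4 →₀ ℕ) (h : m.degree ≤ 7) : decE (encE m) = m := by
  rw [degree_four] at h
  obtain ⟨h1, h2, h3, h4⟩ := digits8 (encE m) (m 0) (m 1) (m 2) (m 3)
    (by omega) (by omega) (by omega) rfl
  ext i
  fin_cases i
  · exact h1
  · exact h2
  · exact h3
  · exact h4

theorem encE_mem (m : Fin 4 →₀ ℕ) (d : ℕ) (hd : d ≤ 7) (h : m.degree = d) : encE m ∈ LL d := by
  rw [degree_four] at h
  obtain ⟨h1, h2, h3, h4⟩ := digits8 (encE m) (m 0) (m 1) (m 2) (m 3)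
    (by omega) (by omega) (by omega) rfl
  simp only [LL, Finset.mem_filter, Finset.mem_range]
  rw [h1, h2, h3, h4]
  refine ⟨?_, h⟩
  simp only [encE]
  omega

theorem degree_decE (c d : ℕ) (h : c ∈ LL d) : (decE c).degree = d := by
  rw [degree_four]
  simp only [LL, Finset.mem_filter, Finset.mem_range] at h
  simp [decE]
  omega

theorem decE_add (c d : ℕ) (hd : d ≤ 6) (h : c ∈ LL d) (k : Fin 4) :
    decE (c + PP k) = Finsupp.single k 1 + decE c ∧ c + PP k ∈ LL (d+1) := by
  have hdeg : (Finsupp.single k 1 + decE c).degree = d + 1 := by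
    rw [map_add, degree_decE c d h, Finsupp.degree_single, add_comm]
  have henc : encE (Finsupp.single k 1 + decE c) = c + PP k := by
    simp only [LL, Finset.mem_filter, Finset.mem_range] at h
    fin_cases k <;> simp [encE, decE, PP] <;> omega
  rw [← henc]
  exact ⟨decE_encE _ (by omega), encE_mem _ _ (by omega) hdeg⟩

variable {K : Type*} [Field K]

theorem homog_eq_span (d : ℕ) (hd : d ≤ 7) : homogeneousSubmodule (Fin 4) K d =
    Submodule.span K ((fun c => monomial (decE c) (1:K)) '' (LL d)) := by
  apply le_antisymm
  · intro f hf
    rw [mem_homogeneousSubmodule] at hf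
    rw [f.as_sum]
    refine Submodule.sum_mem _ fun m hm => ?_
    have hm' : m.degree = d := by
      rw [mem_support_iff] at hm
      have := hf hm
      rw [← this, Finsupp.degree_eq_weight_one]
      rfl
    have : monomial m (coeff m f) = (coeff m f) • monomial m (1:K) := by
      rw [smul_monomial, smul_eq_mul, mul_one]
    rw [this]
    refine Submodule.smul_mem _ _ (Submodule.subset_span ⟨encE m, encE_mem m d hd hm', ?_⟩)
    simp only
    rw [decE_encE m (by omega)]
  · rw [Submodule.span_le]
    rintro _ ⟨c, hc, rfl⟩
    exact isHomogeneous_monomial _ (degree_decE c d hc)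

/-- class of a coded monomial -/
def vv (J : Ideal (MvPolynomial (Fin 4) K)) (c : ℕ) : MvPolynomial (Fin 4) K ⧸ J :=
  Ideal.Quotient.mk J (monomial (decE c) 1)

open Classical in
/-- codes of the standard monomials -/
def NN (J : Ideal (MvPolynomial (Fin 4) K)) (d : ℕ) : Finset ℕ :=
  (LL d).filter (fun a => vv J a ∉ Submodule.span K (vv J '' {b | b ∈ LL d ∧ b < a}))

theorem gr_eq_span (J : Ideal (MvPolynomial (Fin 4) K)) (d : ℕ) (hd : d ≤ 7) :
    (homogeneousSubmodule (Fin 4) K d).map (Ideal.Quotient.mkₐ K J).toLinearMap =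
      Submodule.span K (vv J '' (LL d)) := by
  rw [homog_eq_span d hd, Submodule.map_span, Set.image_image]
  rfl

theorem card_NN (J : Ideal (MvPolynomial (Fin 4) K)) [FiniteDimensional K (MvPolynomial (Fin 4) K ⧸ J)]
    (d : ℕ) (hd : d ≤ 7) : (NN J d).card = hilb 4 K J d := by
  rw [hilb, gr_eq_span J d hd, finrank_span_greedy, NN]

theorem vv_add (J : Ideal (MvPolynomial (Fin 4) K)) (c d : ℕ) (hd : d ≤ 6) (h : c ∈ LL d) (k : Fin 4) :
    vv J (c + PP k) = Ideal.Quotient.mk J (X k) * vv J c := by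
  rw [vv, (decE_add c d hd h k).1, vv, ← map_mul, X, monomial_mul, one_mul]

theorem NN_down (J : Ideal (MvPolynomial (Fin 4) K)) (c d : ℕ) (hd : d ≤ 6) (h : c ∈ LL d) (k : Fin 4)
    (hc : c + PP k ∈ NN J (d+1)) : c ∈ NN J d := by
  classical
  simp only [NN, Finset.mem_filter] at hc ⊢
  refine ⟨h, fun h2 => hc.2 ?_⟩
  rw [vv_add J c d hd h k]
  have := Submodule.mem_map_of_mem (f := LinearMap.mulLeft K (Ideal.Quotient.mk J (X k))) h2
  rw [Submodule.map_span, Set.image_image] at this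
  refine Submodule.span_mono ?_ this
  rintro _ ⟨b, ⟨hb, hb2⟩, rfl⟩
  exact ⟨b + PP k, ⟨(decE_add b d hd hb k).2, by omega⟩, vv_add J b d hd hb k⟩

theorem NN_var (J : Ideal (MvPolynomial (Fin 4) K)) (c d : ℕ) (k : Fin 4) (hX : X k ∈ J)
    (hc : c ∈ NN J d) : decE c k = 0 := by
  classical
  simp only [NN, Finset.mem_filter] at hc
  by_contra h
  apply hc.2
  have : vv J c = 0 := by
    rw [vv, Ideal.Quotient.eq_zero_iff_mem]
    have h1 : decE c = Finsupp.single k 1 + (decE c - Finsupp.single k 1) := by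
      rw [add_tsub_cancel_of_le]
      simpa using Nat.one_le_iff_ne_zero.2 h
    have : monomial (decE c) (1:K) = X k * monomial (decE c - Finsupp.single k 1) 1 := by
      rw [X, monomial_mul, ← h1, one_mul]
    rw [this]
    exact J.mul_mem_right _ hX
  rw [this]
  exact Submodule.zero_mem _

def dig (c : ℕ) (k : Fin 4) : ℕ := c / PP k % 8

def upS (d : ℕ) (L s : Finset ℕ) : Finset ℕ :=
  (LL (d+1)).filter (fun c => ∀ k : Fin 4, c - PP k ∈ L → c - PP k ∈ s)

def A2 : Finset ℕ := {2, 9, 16, 65, 72, 128, 513, 520, 576, 1024}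
def A3 : Finset ℕ := {3, 10, 17, 24, 66, 73, 80, 129, 136, 192, 514, 521, 528, 577, 584, 640, 1025, 1032, 1088, 1536}
def A4 : Finset ℕ := {4, 11, 18, 25, 32, 67, 74, 81, 88, 130, 137, 144, 193, 200, 256, 515, 522, 529, 536, 578, 585, 592, 641, 648, 704, 1026, 1033, 1040, 1089, 1096, 1152, 1537, 1544, 1600, 2048}
theorem LL2 : LL 2 = A2 := by decide +kernel
theorem LL3 : LL 3 = A3 := by decide +kernel
theorem LL4 : LL 4 = A4 := by decide +kernel

theorem comb_a : ∀ s ∈ A2.powersetCard 7,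
    (A3.filter (fun c => ∀ k : Fin 4, c - PP k ∈ A2 → c - PP k ∈ s)).card ≤ 11 := by
  decide +kernel

theorem comb_b : ∀ i : Fin 4, ∀ n ∈ Finset.range 4, ∀ s ∈ (A3.filter (fun c => dig c i = 0)).powersetCard n,
    (A4.filter (fun c => dig c i = 0 ∧ ∀ k : Fin 4, c - PP k ∈ A3 → c - PP k ∈ s)).card ≤ n := by
  decide +kernel

theorem decE_dig (c d : ℕ) (h : c ∈ LL d) (k : Fin 4) : decE c k = dig c k := by
  simp only [LL, Finset.mem_filter, Finset.mem_range] at h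
  fin_cases k <;> simp [decE, dig, PP] <;> omega

theorem NN_sub (J : Ideal (MvPolynomial (Fin 4) K)) (d : ℕ) : NN J d ⊆ LL d := by
  classical
  exact Finset.filter_subset _ _

theorem PP_le (c d : ℕ) (h : c - PP k ∈ LL (d+1)) : PP k ≤ c := by
  by_contra h2
  rw [Nat.sub_eq_zero_of_le (by omega)] at h
  simp [LL] at h

theorem macaulay_a (J : Ideal (MvPolynomial (Fin 4) K)) [FiniteDimensional K (MvPolynomial (Fin 4) K ⧸ J)]
    (h2 : hilb 4 K J 2 = 7) : hilb 4 K J 3 ≤ 11 := by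
  rw [← card_NN J _ (by norm_num)] at h2 ⊢
  refine le_trans (Finset.card_le_card ?_) (comb_a (NN J 2) ?_)
  · intro c hc
    rw [Finset.mem_filter, ← LL3, ← LL2]
    refine ⟨NN_sub J 3 hc, fun k hk => NN_down J _ 2 (by norm_num) hk k ?_⟩
    rw [Nat.sub_add_cancel (PP_le c 1 hk)]
    exact hc
  · rw [Finset.mem_powersetCard, ← LL2]
    exact ⟨NN_sub J 2, h2⟩

theorem macaulay_b (J : Ideal (MvPolynomial (Fin 4) K)) [FiniteDimensional K (MvPolynomial (Fin 4) K ⧸ J)]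
    (i : Fin 4) (hX : X i ∈ J) (h3 : hilb 4 K J 3 ≤ 3) : hilb 4 K J 4 ≤ hilb 4 K J 3 := by
  rw [← card_NN J _ (by norm_num)] at h3
  rw [← card_NN J _ (by norm_num), ← card_NN J _ (by norm_num)]
  refine le_trans (Finset.card_le_card ?_)
    (comb_b i (NN J 3).card (Finset.mem_range.2 (by omega)) (NN J 3) ?_)
  · intro c hc
    rw [Finset.mem_filter, ← LL3, ← LL4]
    refine ⟨NN_sub J 4 hc, ?_, fun k hk => NN_down J _ 3 (by norm_num) hk k ?_⟩
    · rw [← decE_dig c 4 (NN_sub J 4 hc)]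
      exact NN_var J c 4 i hX hc
    · rw [Nat.sub_add_cancel (PP_le c 2 hk)]
      exact hc
  · rw [Finset.mem_powersetCard, ← LL3]
    refine ⟨fun c hc => ?_, rfl⟩
    rw [Finset.mem_filter]
    refine ⟨NN_sub J 3 hc, ?_⟩
    rw [← decE_dig c 3 (NN_sub J 3 hc)]
    exact NN_var J c 3 i hX hc
end Std

section Low
variable {K : Type*} [Field K]

/-- degree-`d` piece of `R/I` -/
def gr (I : Ideal (MvPolynomial (Fin 4) K)) (d : ℕ) : Submodule K (MvPolynomial (Fin 4) K ⧸ I) :=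
  (homogeneousSubmodule (Fin 4) K d).map (Ideal.Quotient.mkₐ K I).toLinearMap

/-- `x_i A_d` -/
def mulBy (I : Ideal (MvPolynomial (Fin 4) K)) (i : Fin 4) (d : ℕ) :
    Submodule K (MvPolynomial (Fin 4) K ⧸ I) :=
  (gr I d).map (LinearMap.mulLeft K (Ideal.Quotient.mk I (X i)))

theorem mem_gr (I : Ideal (MvPolynomial (Fin 4) K)) (d : ℕ) (a : MvPolynomial (Fin 4) K ⧸ I) :
    a ∈ gr I d ↔ ∃ f : MvPolynomial (Fin 4) K, f.IsHomogeneous d ∧ Ideal.Quotient.mk I f = a := by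
  rw [gr, Submodule.mem_map]
  rfl

theorem gr_mul (I : Ideal (MvPolynomial (Fin 4) K)) (d e : ℕ) (a b : MvPolynomial (Fin 4) K ⧸ I)
    (ha : a ∈ gr I d) (hb : b ∈ gr I e) : a * b ∈ gr I (d + e) := by
  rw [mem_gr] at *
  obtain ⟨f, hf, rfl⟩ := ha
  obtain ⟨g, hg, rfl⟩ := hb
  exact ⟨f * g, hf.mul hg, map_mul _ _ _⟩

theorem gr_X (I : Ideal (MvPolynomial (Fin 4) K)) (i : Fin 4) : Ideal.Quotient.mk I (X i) ∈ gr I 1 :=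
  (mem_gr _ _ _).2 ⟨X i, isHomogeneous_X _ _, rfl⟩

theorem gr_Xmul (I : Ideal (MvPolynomial (Fin 4) K)) (i : Fin 4) (d : ℕ)
    (a : MvPolynomial (Fin 4) K ⧸ I) (ha : a ∈ gr I d) :
    Ideal.Quotient.mk I (X i) * a ∈ gr I (d + 1) := by
  rw [add_comm]
  exact gr_mul I 1 d _ _ (gr_X I i) ha

theorem mulBy_le (I : Ideal (MvPolynomial (Fin 4) K)) (i : Fin 4) (d : ℕ) :
    mulBy I i d ≤ gr I (d + 1) := by
  rintro _ ⟨a, ha, rfl⟩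
  exact gr_Xmul I i d a ha

theorem comp_mul_X (f : MvPolynomial (Fin 4) K) (i : Fin 4) (d : ℕ) :
    homogeneousComponent (d + 1) (f * X i) = homogeneousComponent d f * X i := by
  conv_lhs => rw [← sum_homogeneousComponent f, Finset.sum_mul, map_sum]
  have : ∀ j ∈ Finset.range (f.totalDegree + 1),
      homogeneousComponent (d + 1) (homogeneousComponent j f * X i) =
        if j = d then homogeneousComponent d f * X i else 0 := by
    intro j _
    rw [homogeneousComponent_of_mem
      (((homogeneousComponent_isHomogeneous j f).mul (isHomogeneous_X K i)))]
    by_cases h : j = d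
    · subst h; simp
    · rw [if_neg h, if_neg (by omega)]
  rw [Finset.sum_congr rfl this, Finset.sum_ite_eq']
  split_ifs with h
  · rfl
  · rw [homogeneousComponent_eq_zero, zero_mul]
    simp at h
    omega

theorem gr_eq_zero_of_eq (I : Ideal (MvPolynomial (Fin 4) K)) (hI : IdealHomog I) (d e : ℕ) (hde : d ≠ e)
    (a : MvPolynomial (Fin 4) K ⧸ I) (h1 : a ∈ gr I d) (h2 : a ∈ gr I e) : a = 0 := by
  rw [mem_gr] at *
  obtain ⟨f, hf, rfl⟩ := h1
  obtain ⟨g, hg, h⟩ := h2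
  rw [Ideal.Quotient.eq_zero_iff_mem]
  rw [Ideal.Quotient.eq] at h
  have := hI _ h d
  rw [map_sub, homogeneousComponent_of_mem hg, homogeneousComponent_of_mem hf, if_neg hde,
    if_pos rfl, zero_sub, neg_mem_iff] at this
  exact this

/-- `I + (x_i, x_j)` -/
def addV (I : Ideal (MvPolynomial (Fin 4) K)) (i j : Fin 4) : Ideal (MvPolynomial (Fin 4) K) :=
  I ⊔ Ideal.span {X i, X j}

theorem hilb_addV (I : Ideal (MvPolynomial (Fin 4) K)) (hI : IdealHomog I)
    [FiniteDimensional K (MvPolynomial (Fin 4) K ⧸ I)] (i j : Fin 4) (d : ℕ) :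
    hilb 4 K (addV I i j) (d + 1) + Module.finrank K (mulBy I i d ⊔ mulBy I j d : Submodule K _) =
      Module.finrank K (gr I (d + 1)) := by
  let F : (MvPolynomial (Fin 4) K ⧸ I) →ₗ[K] (MvPolynomial (Fin 4) K ⧸ addV I i j) :=
    (Ideal.Quotient.factorₐ K (le_sup_left : I ≤ addV I i j)).toLinearMap
  have hF : ∀ f, F (Ideal.Quotient.mk I f) = Ideal.Quotient.mk (addV I i j) f := fun f => rfl
  have h1 : gr (addV I i j) (d + 1) = (gr I (d + 1)).map F := by
    rw [gr, gr, ← Submodule.map_comp]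
    rfl
  have h2 : mulBy I i d ⊔ mulBy I j d = gr I (d + 1) ⊓ LinearMap.ker F := by
    apply le_antisymm
    · apply sup_le
      · refine le_inf (mulBy_le I i d) ?_
        rintro _ ⟨a, ha, rfl⟩
        obtain ⟨f, hf, rfl⟩ := (mem_gr _ _ _).1 ha
        rw [LinearMap.mem_ker, LinearMap.mulLeft_apply, ← map_mul, hF, Ideal.Quotient.eq_zero_iff_mem]
        exact Ideal.mul_mem_right _ _ (Ideal.mem_sup_right (Ideal.subset_span (by simp)))
      · refine le_inf (mulBy_le I j d) ?_
        rintro _ ⟨a, ha, rfl⟩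
        obtain ⟨f, hf, rfl⟩ := (mem_gr _ _ _).1 ha
        rw [LinearMap.mem_ker, LinearMap.mulLeft_apply, ← map_mul, hF, Ideal.Quotient.eq_zero_iff_mem]
        exact Ideal.mul_mem_right _ _ (Ideal.mem_sup_right (Ideal.subset_span (by simp)))
    · rintro a ⟨ha, hk⟩
      obtain ⟨f, hf, rfl⟩ := (mem_gr _ _ _).1 ha
      change F (Ideal.Quotient.mk I f) = 0 at hk
      rw [hF, Ideal.Quotient.eq_zero_iff_mem, addV, Submodule.mem_sup] at hk
      obtain ⟨g, hg, p, hp, hgp⟩ := hk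
      obtain ⟨u, v, rfl⟩ := Ideal.mem_span_pair.1 hp
      have h3 := congrArg (homogeneousComponent (d + 1)) hgp
      rw [map_add, map_add, comp_mul_X, comp_mul_X, homogeneousComponent_of_mem hf, if_pos rfl] at h3
      rw [← h3, map_add, map_add, Ideal.Quotient.eq_zero_iff_mem.2 (hI g hg (d+1)), zero_add,
        mul_comm _ (X i), mul_comm _ (X j)]
      refine Submodule.add_mem_sup ?_ ?_
      · exact ⟨_, (mem_gr _ _ _).2 ⟨_, homogeneousComponent_isHomogeneous d u, rfl⟩, by simp⟩
      · exact ⟨_, (mem_gr _ _ _).2 ⟨_, homogeneousComponent_isHomogeneous d v, rfl⟩, by simp⟩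
  have h3 := LinearMap.finrank_range_add_finrank_ker (F.domRestrict (gr I (d + 1)))
  rw [LinearMap.range_domRestrict, ← h1] at h3
  rw [← h3, h2]
  have h4 : Module.finrank K (LinearMap.ker (F.domRestrict (gr I (d + 1)))) =
      Module.finrank K (gr I (d + 1) ⊓ LinearMap.ker F : Submodule K _) := by
    rw [LinearMap.ker_domRestrict]
    rw [← Submodule.map_comap_subtype]
    exact (LinearEquiv.finrank_eq (Submodule.equivMapOfInjective _ (Submodule.injective_subtype _) _))
  rw [h4]
  rfl

theorem exists_pairing (I : Ideal (MvPolynomial (Fin 4) K)) (hI : IsAG 4 K I 6) :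
    ∀ d, d < 6 → ∀ a ∈ gr I d, a ≠ 0 → ∃ k, Ideal.Quotient.mk I (X k) * a ≠ 0 := by
  obtain ⟨hh, hfd, hs, h6, h7⟩ := hI
  have hle : gr I 6 ≤ socleSub 4 K I := by
    intro a ha
    rw [socleSub, Submodule.mem_iInf]
    intro k
    rw [LinearMap.mem_ker, LinearMap.mulLeft_apply]
    have h := gr_Xmul I k 6 a ha
    have h0 : gr I 7 = ⊥ := Submodule.finrank_eq_zero.1 (h7 7 (by norm_num))
    rw [h0] at h
    exact h
  have heq : gr I 6 = socleSub 4 K I := by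
    apply Submodule.eq_of_le_of_finrank_le hle
    rw [hs]
    exact Nat.one_le_iff_ne_zero.2 h6
  intro d hd a ha ha0
  by_contra hcon
  push Not at hcon
  apply ha0
  refine gr_eq_zero_of_eq I hh d 6 (by omega) a ha ?_
  rw [heq, socleSub, Submodule.mem_iInf]
  intro k
  exact hcon k

theorem rank_mulBy_le (I : Ideal (MvPolynomial (Fin 4) K)) (hI : IsAG 4 K I 6) (h6 : hilb 4 K I 6 = 1)
    (i : Fin 4) : Module.finrank K (mulBy I i 3) ≤ Module.finrank K (mulBy I i 2) := by
  have hfd := hI.2.1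
  have hp := exists_pairing I hI
  obtain ⟨φ, hφ⟩ : ∃ φ : Module.Dual K (MvPolynomial (Fin 4) K ⧸ I), ∀ a ∈ gr I 6, φ a = 0 → a = 0 := by
    obtain ⟨e, he0, he⟩ := finrank_eq_one_iff'.1 h6
    have he0' : (e : MvPolynomial (Fin 4) K ⧸ I) ≠ 0 := by simpa using he0
    obtain ⟨φ, hφ⟩ := Module.Projective.exists_dual_ne_zero K he0'
    refine ⟨φ, fun a ha h => ?_⟩
    obtain ⟨c, hc⟩ := he ⟨a, ha⟩
    have hc' : c • (e : MvPolynomial (Fin 4) K ⧸ I) = a := congrArg Subtype.val hc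
    rw [← hc', map_smul, smul_eq_mul, mul_eq_zero] at h
    rcases h with h | h
    · rw [← hc', h, zero_smul]
    · exact absurd h hφ
  let m := (LinearMap.mulLeft K (Ideal.Quotient.mk I (X i))).domRestrict (gr I 3)
  let B : (MvPolynomial (Fin 4) K ⧸ I) →ₗ[K] Module.Dual K (mulBy I i 2) :=
    { toFun := fun b => (φ ∘ₗ LinearMap.mulLeft K b) ∘ₗ (mulBy I i 2).subtype
      map_add' := by intro a b; ext; simp [add_mul]
      map_smul' := by
        intro a b
        ext x
        change φ (a • b * x) = a • φ (b * x)
        rw [smul_mul_assoc, map_smul] }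
  have hker : LinearMap.ker (B.domRestrict (gr I 3)) ≤ LinearMap.ker m := by
    rintro ⟨b, hb⟩ hB
    rw [LinearMap.mem_ker] at hB ⊢
    change Ideal.Quotient.mk I (X i) * b = 0
    by_contra hne
    have hb4 := gr_Xmul I i 3 b hb
    obtain ⟨k, hk⟩ := hp 4 (by norm_num) _ hb4 hne
    have hb5 := gr_Xmul I k _ _ hb4
    obtain ⟨l, hl⟩ := hp 5 (by norm_num) _ hb5 hk
    have hb6 := gr_Xmul I l _ _ hb5
    apply hl
    apply hφ _ hb6
    have hmem : Ideal.Quotient.mk I (X i) * (Ideal.Quotient.mk I (X l) * Ideal.Quotient.mk I (X k)) ∈ mulBy I i 2 :=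
      ⟨_, gr_Xmul I l 1 _ (gr_X I k), rfl⟩
    have := LinearMap.congr_fun hB ⟨_, hmem⟩
    change φ (b * (Ideal.Quotient.mk I (X i) * (Ideal.Quotient.mk I (X l) * Ideal.Quotient.mk I (X k)))) = 0 at this
    rw [← this]
    congr 1
    ring
  have e1 := LinearMap.finrank_range_add_finrank_ker m
  have e2 := LinearMap.finrank_range_add_finrank_ker (B.domRestrict (gr I 3))
  have e3 := Submodule.finrank_mono hker
  have e4 : Module.finrank K (LinearMap.range (B.domRestrict (gr I 3))) ≤ Module.finrank K (mulBy I i 2) := by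
    rw [← Subspace.dual_finrank_eq (K := K) (V := mulBy I i 2)]
    exact Submodule.finrank_le _
  have e5 : LinearMap.range m = mulBy I i 3 := LinearMap.range_domRestrict _ _
  rw [e5] at e1
  omega


theorem addV_finite (I : Ideal (MvPolynomial (Fin 4) K))
    [FiniteDimensional K (MvPolynomial (Fin 4) K ⧸ I)] (i j : Fin 4) :
    FiniteDimensional K (MvPolynomial (Fin 4) K ⧸ addV I i j) := by
  refine Module.Finite.of_surjective
    (Ideal.Quotient.factorₐ K (le_sup_left : I ≤ addV I i j)).toLinearMap ?_
  exact Ideal.Quotient.factor_surjective (le_sup_left : I ≤ addV I i j)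

theorem lower_bound (I : Ideal (MvPolynomial (Fin 4) K)) (hI : IsAG 4 K I 6)
    (h4 : hilb 4 K I 4 = 7) (h6 : hilb 4 K I 6 = 1) : 7 ≤ hilb 4 K I 3 := by
  classical
  have hfd := hI.2.1
  have hfin := addV_finite I
  by_contra hlt
  have h4' : Module.finrank K (gr I 4) = 7 := h4
  have h3' : Module.finrank K (gr I 3) = hilb 4 K I 3 := rfl
  have hX : ∀ i j, X i ∈ addV I i j := fun i j =>
    Ideal.mem_sup_right (Ideal.subset_span (by simp))
  have hr : ∀ i, Module.finrank K (mulBy I i 3) ≤ 2 := by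
    intro i
    have a1 := hilb_addV I hI.1 i i 2
    have a2 := hilb_addV I hI.1 i i 3
    rw [sup_idem] at a1 a2
    have a3 := rank_mulBy_le I hI h6 i
    change hilb 4 K (addV I i i) 3 + _ = _ at a1
    change hilb 4 K (addV I i i) 4 + _ = _ at a2
    have a4 := macaulay_b (addV I i i) i (hX i i)
    change _ = Module.finrank K (gr I 3) at a1
    change _ = Module.finrank K (gr I 4) at a2
    omega
  have hc : ∀ i j, 3 + Module.finrank K (mulBy I i 2 ⊔ mulBy I j 2 : Submodule K _) ≤
      Module.finrank K (gr I 3) := by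
    intro i j
    have a1 := hilb_addV I hI.1 i j 2
    have a2 := hilb_addV I hI.1 i j 3
    change hilb 4 K (addV I i j) 3 + _ = _ at a1
    change hilb 4 K (addV I i j) 4 + _ = _ at a2
    have a4 := macaulay_b (addV I i j) i (hX i j)
    have a5 := Submodule.finrank_add_le_finrank_add_finrank (mulBy I i 3) (mulBy I j 3)
    have a6 := hr i
    have a7 := hr j
    change _ = Module.finrank K (gr I 3) at a1
    change _ = Module.finrank K (gr I 4) at a2
    omega
  have hspan : ∀ W : Submodule K (MvPolynomial (Fin 4) K ⧸ I),
      (∀ c ∈ A3, vv I c ∈ W) → gr I 3 ≤ W := by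
    intro W hW
    rw [gr, gr_eq_span I 3 (by norm_num), Submodule.span_le, LL3]
    rintro _ ⟨c, hc, rfl⟩
    exact hW c hc
  have hmul : ∀ (c : ℕ) (k : Fin 4), c ∈ A2 → vv I (c + PP k) ∈ mulBy I k 2 := by
    intro c k hc
    rw [← LL2] at hc
    rw [vv_add I c 2 (by norm_num) hc k]
    refine ⟨vv I c, ?_, rfl⟩
    rw [gr, gr_eq_span I 2 (by norm_num)]
    exact Submodule.subset_span ⟨c, hc, rfl⟩
  have hdiv : ∀ c ∈ A3, ∀ k : Fin 4, c - PP k ∈ A2 → vv I c ∈ mulBy I k 2 := by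
    intro c hc k hk
    have := hmul _ k hk
    rwa [Nat.sub_add_cancel (PP_le c 1 (by rw [LL2]; exact hk))] at this
  have htop : gr I 3 ≤ (mulBy I 0 2 ⊔ mulBy I 1 2) ⊔ (mulBy I 2 2 ⊔ mulBy I 3 2) := by
    apply hspan
    intro c hc
    have : ∀ c ∈ A3, c - PP 0 ∈ A2 ∨ c - PP 1 ∈ A2 ∨ c - PP 2 ∈ A2 ∨ c - PP 3 ∈ A2 := by
      decide +kernel
    rcases this c hc with h | h | h | h
    · exact Submodule.mem_sup_left (Submodule.mem_sup_left (hdiv c hc _ h))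
    · exact Submodule.mem_sup_left (Submodule.mem_sup_right (hdiv c hc _ h))
    · exact Submodule.mem_sup_right (Submodule.mem_sup_left (hdiv c hc _ h))
    · exact Submodule.mem_sup_right (Submodule.mem_sup_right (hdiv c hc _ h))
  have b1 := Submodule.finrank_sup_add_finrank_inf_eq (mulBy I 0 2 ⊔ mulBy I 1 2) (mulBy I 2 2 ⊔ mulBy I 3 2)
  have b2 := Submodule.finrank_mono htop
  have b3 := hc 0 1
  have b4 := hc 2 3
  have hinf : (mulBy I 0 2 ⊔ mulBy I 1 2) ⊓ (mulBy I 2 2 ⊔ mulBy I 3 2) = ⊥ := by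
    apply Submodule.finrank_eq_zero.1
    omega
  have hzero : ∀ c ∈ A3, c - PP 0 ∈ A2 → c - PP 2 ∈ A2 → vv I c = 0 := by
    intro c hc h0 h2
    have : vv I c ∈ (mulBy I 0 2 ⊔ mulBy I 1 2) ⊓ (mulBy I 2 2 ⊔ mulBy I 3 2) :=
      ⟨Submodule.mem_sup_left (hdiv c hc _ h0), Submodule.mem_sup_left (hdiv c hc _ h2)⟩
    rw [hinf] at this
    exact this
  have hlast : gr I 3 ≤ (mulBy I 1 2 ⊔ mulBy I 3 2) ⊔ Submodule.span K ({vv I 3, vv I 192} : Finset _) := by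
    apply hspan
    intro c hc
    have : ∀ c ∈ A3, (c - PP 0 ∈ A2 ∧ c - PP 2 ∈ A2) ∨ c - PP 1 ∈ A2 ∨ c - PP 3 ∈ A2 ∨ c = 3 ∨ c = 192 := by
      decide +kernel
    rcases this c hc with h | h | h | h | h
    · rw [hzero c hc h.1 h.2]
      exact Submodule.zero_mem _
    · exact Submodule.mem_sup_left (Submodule.mem_sup_left (hdiv c hc _ h))
    · exact Submodule.mem_sup_left (Submodule.mem_sup_right (hdiv c hc _ h))
    · exact Submodule.mem_sup_right (Submodule.subset_span (by simp [h]))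
    · exact Submodule.mem_sup_right (Submodule.subset_span (by simp [h]))
  have c1 := Submodule.finrank_mono hlast
  have c2 := Submodule.finrank_add_le_finrank_add_finrank (mulBy I 1 2 ⊔ mulBy I 3 2)
    (Submodule.span K (({vv I 3, vv I 192} : Finset _) : Set (MvPolynomial (Fin 4) K ⧸ I)))
  have c3 := finrank_span_finset_le_card (R := K) ({vv I 3, vv I 192} : Finset (MvPolynomial (Fin 4) K ⧸ I))
  have c4 := Finset.card_le_two (a := vv I 3) (b := vv I 192)
  have c5 := hc 1 3
  rw [Set.finrank] at c3
  omega

end Low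

section Ex
variable {K : Type*} [Field K]

/-- functional on `R` given by a set of coded degree-6 monomials -/
def phi (K : Type*) [Field K] (S : Finset ℕ) : MvPolynomial (Fin 4) K →ₗ[K] K :=
  ∑ s ∈ S, lcoeff K (decE s)

theorem phi_apply (S : Finset ℕ) (f : MvPolynomial (Fin 4) K) :
    phi K S f = ∑ s ∈ S, coeff (decE s) f := by
  simp [phi, LinearMap.sum_apply]

/-- the annihilator ideal -/
def annI (K : Type*) [Field K] (S : Finset ℕ) : Ideal (MvPolynomial (Fin 4) K) where
  carrier := {f | ∀ g, phi K S (f * g) = 0}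
  add_mem' := by
    intro a b ha hb g
    rw [add_mul, map_add, ha g, hb g, add_zero]
  zero_mem' := by
    intro g
    rw [zero_mul, map_zero]
  smul_mem' := by
    intro c f hf g
    have := hf (c * g)
    rwa [smul_eq_mul, mul_comm c f, mul_assoc]

theorem mem_annI (S : Finset ℕ) (f : MvPolynomial (Fin 4) K) :
    f ∈ annI K S ↔ ∀ m, phi K S (f * monomial m 1) = 0 := by
  constructor
  · intro h m
    exact h _
  · intro h g
    rw [g.as_sum, Finset.mul_sum, map_sum]
    refine Finset.sum_eq_zero fun m _ => ?_
    have : monomial m (coeff m g) = (coeff m g) • monomial m (1:K) := by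
      rw [smul_monomial, smul_eq_mul, mul_one]
    rw [this, mul_smul_comm, map_smul, h m, smul_zero]

theorem encE_decE (c : ℕ) : encE (decE c) = c := by
  simp [encE, decE]
  omega

theorem encE_add (p q : Fin 4 →₀ ℕ) : encE (p + q) = encE p + encE q := by
  simp [encE]
  ring

theorem phi_monomial (S : Finset ℕ) (hS : S ⊆ LL 6) (p : Fin 4 →₀ ℕ) :
    phi K S (monomial p 1) = if p.degree = 6 ∧ encE p ∈ S then 1 else 0 := by
  classical
  rw [phi_apply]
  by_cases h : p.degree = 6
  · simp only [h, true_and]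
    have : ∀ s ∈ S, coeff (decE s) (monomial p (1:K)) = if encE p = s then 1 else 0 := by
      intro s hs
      rw [coeff_monomial]
      congr 1
      apply propext
      constructor
      · rintro rfl
        exact encE_decE s
      · rintro rfl
        exact (decE_encE p (by omega)).symm
    rw [Finset.sum_congr rfl this, Finset.sum_ite_eq]
  · rw [if_neg (fun h' => h h'.1)]
    refine Finset.sum_eq_zero fun s hs => ?_
    rw [coeff_monomial, if_neg]
    rintro rfl
    exact h (degree_decE s 6 (hS hs))

theorem annI_homog (S : Finset ℕ) (hS : S ⊆ LL 6) : IdealHomog (annI K S) := by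
  intro f hf d
  rw [mem_annI] at hf ⊢
  intro m
  have h := hf m
  rw [phi_apply] at h ⊢
  simp only [coeff_mul_monomial', mul_one] at h ⊢
  by_cases hd : d + m.degree = 6
  · refine Eq.trans (Finset.sum_congr rfl fun s hs => ?_) h
    split_ifs with hm
    · rw [coeff_homogeneousComponent, if_pos]
      have h1 := degree_decE s 6 (hS hs)
      rw [← tsub_add_cancel_of_le hm, map_add] at h1
      omega
    · rfl
  · refine Finset.sum_eq_zero fun s hs => ?_
    split_ifs with hm
    · rw [coeff_homogeneousComponent, if_neg]
      have h1 := degree_decE s 6 (hS hs)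
      rw [← tsub_add_cancel_of_le hm, map_add] at h1
      omega
    · rfl

theorem annI_high (S : Finset ℕ) (hS : S ⊆ LL 6) (d : ℕ) (hd : 6 < d) (f : MvPolynomial (Fin 4) K)
    (hf : f.IsHomogeneous d) : f ∈ annI K S := by
  rw [mem_annI]
  intro m
  rw [phi_apply]
  refine Finset.sum_eq_zero fun s hs => ?_
  refine (hf.mul (isHomogeneous_monomial (1:K) rfl)).coeff_eq_zero ?_
  rw [degree_decE s 6 (hS hs)]
  omega

theorem annI_hilb_high (S : Finset ℕ) (hS : S ⊆ LL 6) (d : ℕ) (hd : 6 < d) :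
    hilb 4 K (annI K S) d = 0 := by
  have : gr (annI K S) d = ⊥ := by
    rw [eq_bot_iff]
    intro a ha
    obtain ⟨f, hf, rfl⟩ := (mem_gr _ _ _).1 ha
    exact Ideal.Quotient.eq_zero_iff_mem.2 (annI_high S hS d hd f hf)
  change Module.finrank K (gr (annI K S) d) = 0
  rw [this, finrank_bot]

theorem annI_finite (S : Finset ℕ) (hS : S ⊆ LL 6) :
    FiniteDimensional K (MvPolynomial (Fin 4) K ⧸ annI K S) := by
  classical
  refine ⟨⟨((Finset.range 4096).image (vv (annI K S))), ?_⟩⟩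
  · rw [eq_top_iff]
    rintro a -
    obtain ⟨f, rfl⟩ := Ideal.Quotient.mk_surjective a
    rw [← sum_homogeneousComponent f, map_sum]
    refine Submodule.sum_mem _ fun d _ => ?_
    by_cases hd : 6 < d
    · rw [Ideal.Quotient.eq_zero_iff_mem.2
        (annI_high S hS d hd _ (homogeneousComponent_isHomogeneous d f))]
      exact Submodule.zero_mem _
    · have h1 : Ideal.Quotient.mk (annI K S) (homogeneousComponent d f) ∈ gr (annI K S) d :=
        (mem_gr _ _ _).2 ⟨_, homogeneousComponent_isHomogeneous d f, rfl⟩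
      rw [gr, gr_eq_span _ d (by omega)] at h1
      refine Submodule.span_mono ?_ h1
      rintro _ ⟨c, hc, rfl⟩
      have hc' : c ∈ Finset.range 4096 := (Finset.mem_filter.1 hc).1
      exact Finset.mem_coe.2 (Finset.mem_image_of_mem _ hc')

theorem annI_socle (S : Finset ℕ) (hS : S ⊆ LL 6) (s : ℕ) (hs : s ∈ S) :
    Module.finrank K (socleSub 4 K (annI K S)) = 1 := by
  have hdeg := degree_decE s 6 (hS hs)
  have hphi : phi K S (monomial (decE s) 1) = 1 := by
    rw [phi_monomial S hS, if_pos]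
    exact ⟨hdeg, by rwa [encE_decE]⟩
  have hmem : vv (annI K S) s ∈ socleSub 4 K (annI K S) := by
    rw [socleSub, Submodule.mem_iInf]
    intro k
    rw [LinearMap.mem_ker, LinearMap.mulLeft_apply, vv, ← map_mul, Ideal.Quotient.eq_zero_iff_mem]
    exact annI_high S hS 7 (by norm_num) _
      ((isHomogeneous_X K k).mul (isHomogeneous_monomial (1:K) hdeg))
  refine finrank_eq_one (⟨_, hmem⟩ : socleSub 4 K (annI K S)) ?_ ?_
  · intro h0
    have h1 : vv (annI K S) s = 0 := congrArg Subtype.val h0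
    rw [vv, Ideal.Quotient.eq_zero_iff_mem] at h1
    have := h1 1
    rw [mul_one, hphi] at this
    exact one_ne_zero this
  · rintro ⟨w, hw⟩
    obtain ⟨f, rfl⟩ := Ideal.Quotient.mk_surjective w
    refine ⟨phi K S f, Subtype.ext ?_⟩
    change phi K S f • vv (annI K S) s = _
    have e : phi K S f • vv (annI K S) s =
        Ideal.Quotient.mk (annI K S) (phi K S f • monomial (decE s) 1) := rfl
    rw [e, Ideal.Quotient.eq, mem_annI]
    intro m
    rw [sub_mul, map_sub, smul_mul_assoc, map_smul]
    by_cases hm : m = 0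
    · subst hm
      rw [show monomial (0 : Fin 4 →₀ ℕ) (1:K) = 1 from rfl, mul_one, mul_one, hphi]
      simp
    · obtain ⟨k, hk⟩ : ∃ k, m k ≠ 0 := by
        by_contra hcon
        push Not at hcon
        exact hm (Finsupp.ext hcon)
      have h1 : m = Finsupp.single k 1 + (m - Finsupp.single k 1) := by
        rw [add_tsub_cancel_of_le]
        simpa using Nat.one_le_iff_ne_zero.2 hk
      have h2 : monomial m (1:K) = X k * monomial (m - Finsupp.single k 1) 1 := by
        rw [X, monomial_mul, ← h1, one_mul]
      have h3 : X k * f ∈ annI K S := by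
        rw [socleSub, Submodule.mem_iInf] at hw
        have := hw k
        rwa [LinearMap.mem_ker, LinearMap.mulLeft_apply, ← map_mul,
          Ideal.Quotient.eq_zero_iff_mem] at this
      have h4 : phi K S (f * monomial m 1) = 0 := by
        rw [h2, ← mul_assoc, mul_comm f]
        exact h3 _
      rw [h4, monomial_mul, one_mul, phi_monomial S hS, if_neg, smul_zero, sub_zero]
      rintro ⟨h5, -⟩
      rw [map_add, hdeg, h1, map_add, Finsupp.degree_single] at h5
      omega

theorem phi_mul (S : Finset ℕ) (hS : S ⊆ LL 6) (c d : ℕ) (hc : c ∈ LL d) (hd : d ≤ 6) (m : Fin 4 →₀ ℕ) :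
    phi K S (monomial (decE c) 1 * monomial m 1) =
      if m.degree = 6 - d ∧ c + encE m ∈ S then 1 else 0 := by
  rw [monomial_mul, one_mul, phi_monomial S hS, encE_add, encE_decE, map_add, degree_decE c d hc]
  congr 1
  apply propext
  constructor
  · rintro ⟨h1, h2⟩
    exact ⟨by omega, h2⟩
  · rintro ⟨h1, h2⟩
    exact ⟨by omega, h2⟩

/-- combinatorial check that `reps` gives a basis in a degree with monomials `L`,
complementary monomials `U`. -/
def Chk (S L U reps : Finset ℕ) : Prop :=
  (∀ r ∈ reps, r ∈ L) ∧
  (∀ c ∈ L, (∀ u ∈ U, c + u ∉ S) ∨ ∃ r ∈ reps, ∀ u ∈ U, (c + u ∈ S ↔ r + u ∈ S)) ∧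
  (∀ r ∈ reps, ∃ u ∈ U, r + u ∈ S ∧ ∀ r' ∈ reps, r' + u ∈ S → r' = r)

instance (S L U reps : Finset ℕ) : Decidable (Chk S L U reps) := by
  unfold Chk
  infer_instance

theorem hilb_of_chk (S : Finset ℕ) (hS : S ⊆ LL 6) (d : ℕ) (hd : d ≤ 6) (reps : Finset ℕ)
    (h : Chk S (LL d) (LL (6 - d)) reps) : hilb 4 K (annI K S) d = reps.card := by
  classical
  obtain ⟨h0, h1, h2⟩ := h
  have hspan : Submodule.span K (vv (annI K S) '' (LL d)) =
      Submodule.span K (Set.range (fun r : reps => vv (annI K S) r)) := by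
    apply le_antisymm
    · rw [Submodule.span_le]
      rintro _ ⟨c, hc, rfl⟩
      rcases h1 c hc with h | ⟨r, hr, h⟩
      · have : vv (annI K S) c = 0 := by
          rw [vv, Ideal.Quotient.eq_zero_iff_mem, mem_annI]
          intro m
          rw [phi_mul S hS c d hc hd, if_neg]
          rintro ⟨h3, h4⟩
          exact h _ (encE_mem m (6 - d) (by omega) h3) h4
        rw [this]
        exact Submodule.zero_mem _
      · have : vv (annI K S) c = vv (annI K S) r := by
          rw [vv, vv, Ideal.Quotient.eq, mem_annI]
          intro m
          rw [sub_mul, map_sub, phi_mul S hS c d hc hd, phi_mul S hS r d (h0 r hr) hd, sub_eq_zero]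
          congr 1
          apply propext
          apply and_congr_right
          intro h3
          exact h _ (encE_mem m (6 - d) (by omega) h3)
        rw [this]
        exact Submodule.subset_span ⟨⟨r, hr⟩, rfl⟩
    · apply Submodule.span_mono
      rintro _ ⟨⟨r, hr⟩, rfl⟩
      exact ⟨r, h0 r hr, rfl⟩
  rw [hilb, gr_eq_span _ d (by omega), hspan, finrank_span_eq_card, Fintype.card_coe]
  rw [Fintype.linearIndependent_iff]
  intro g hg ⟨r, hr⟩
  obtain ⟨u, hu, hru, hu2⟩ := h2 r hr
  have e : ∑ i : reps, g i • vv (annI K S) i =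
      Ideal.Quotient.mk (annI K S) (∑ i : reps, g i • monomial (decE i) 1) := by
    rw [map_sum]
    rfl
  rw [e, Ideal.Quotient.eq_zero_iff_mem, mem_annI] at hg
  have h3 := hg (decE u)
  rw [Finset.sum_mul, map_sum] at h3
  rw [Finset.sum_eq_single ⟨r, hr⟩] at h3
  · rw [smul_mul_assoc, map_smul, phi_mul S hS r d (h0 r hr) hd, encE_decE, if_pos, smul_eq_mul,
      mul_one] at h3
    · exact h3
    · exact ⟨degree_decE u _ hu, hru⟩
  · rintro ⟨r', hr'⟩ _ hne
    rw [smul_mul_assoc, map_smul, phi_mul S hS r' d (h0 r' hr') hd, encE_decE, if_neg, smul_zero]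
    rintro ⟨-, h5⟩
    exact hne (Subtype.ext (hu2 r' hr' h5))
  · intro h
    exact absurd (Finset.mem_univ _) h

def A0 : Finset ℕ := {0}
theorem LL0 : LL 0 = A0 := by decide +kernel
def A1 : Finset ℕ := {1, 8, 64, 512}
theorem LL1 : LL 1 = A1 := by decide +kernel
def A5 : Finset ℕ := {5, 12, 19, 26, 33, 40, 68, 75, 82, 89, 96, 131, 138, 145, 152, 194, 201, 208, 257, 264, 320, 516, 523, 530, 537, 544, 579, 586, 593, 600, 642, 649, 656, 705, 712, 768, 1027, 1034, 1041, 1048, 1090, 1097, 1104, 1153, 1160, 1216, 1538, 1545, 1552, 1601, 1608, 1664, 2049, 2056, 2112, 2560}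
theorem LL5 : LL 5 = A5 := by decide +kernel
def A6 : Finset ℕ := {6, 13, 20, 27, 34, 41, 48, 69, 76, 83, 90, 97, 104, 132, 139, 146, 153, 160, 195, 202, 209, 216, 258, 265, 272, 321, 328, 384, 517, 524, 531, 538, 545, 552, 580, 587, 594, 601, 608, 643, 650, 657, 664, 706, 713, 720, 769, 776, 832, 1028, 1035, 1042, 1049, 1056, 1091, 1098, 1105, 1112, 1154, 1161, 1168, 1217, 1224, 1280, 1539, 1546, 1553, 1560, 1602, 1609, 1616, 1665, 1672, 1728, 2050, 2057, 2064, 2113, 2120, 2176, 2561, 2568, 2624, 3072}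
theorem LL6 : LL 6 = A6 := by decide +kernel

theorem build (S : Finset ℕ) (hS : S ⊆ A6) (s : ℕ) (hs : s ∈ S) (h : ℕ) (r0 r1 r2 r3 r4 r5 r6 : Finset ℕ)
    (c0 : Chk S A0 A6 r0) (c1 : Chk S A1 A5 r1) (c2 : Chk S A2 A4 r2) (c3 : Chk S A3 A3 r3)
    (c4 : Chk S A4 A2 r4) (c5 : Chk S A5 A1 r5) (c6 : Chk S A6 A0 r6)
    (e0 : r0.card = 1) (e1 : r1.card = 4) (e2 : r2.card = 7) (e3 : r3.card = h)
    (e4 : r4.card = 7) (e5 : r5.card = 4) (e6 : r6.card = 1) :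
    ∃ I : Ideal (MvPolynomial (Fin 4) K), IsAG 4 K I 6 ∧
      hilb 4 K I 0 = 1 ∧ hilb 4 K I 1 = 4 ∧ hilb 4 K I 2 = 7 ∧ hilb 4 K I 3 = h ∧
      hilb 4 K I 4 = 7 ∧ hilb 4 K I 5 = 4 ∧ hilb 4 K I 6 = 1 := by
  rw [← LL6] at hS
  rw [← LL0, ← LL6] at c0 c6
  rw [← LL1, ← LL5] at c1 c5
  rw [← LL2, ← LL4] at c2 c4
  rw [← LL3] at c3
  have t6 := (hilb_of_chk (K := K) S hS 6 (by norm_num) r6 c6).trans e6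
  refine ⟨annI K S, ⟨annI_homog S hS, annI_finite S hS, annI_socle S hS s hs, ?_,
    fun i hi => annI_hilb_high S hS i hi⟩,
    (hilb_of_chk S hS 0 (by norm_num) r0 c0).trans e0,
    (hilb_of_chk S hS 1 (by norm_num) r1 c1).trans e1,
    (hilb_of_chk S hS 2 (by norm_num) r2 c2).trans e2,
    (hilb_of_chk S hS 3 (by norm_num) r3 c3).trans e3,
    (hilb_of_chk S hS 4 (by norm_num) r4 c4).trans e4,
    (hilb_of_chk S hS 5 (by norm_num) r5 c5).trans e5, t6⟩
  rw [t6]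
  exact one_ne_zero

theorem exists_7 : ∃ I : Ideal (MvPolynomial (Fin 4) K), IsAG 4 K I 6 ∧
      hilb 4 K I 0 = 1 ∧ hilb 4 K I 1 = 4 ∧ hilb 4 K I 2 = 7 ∧ hilb 4 K I 3 = 7 ∧
      hilb 4 K I 4 = 7 ∧ hilb 4 K I 5 = 4 ∧ hilb 4 K I 6 = 1 :=
  build {265, 6, 48, 3072} (by decide +kernel) 3072 (by decide +kernel) 7
    {0}
    {1, 8, 64, 512}
    {2, 9, 16, 65, 72, 128, 1024}
    {3, 24, 73, 129, 136, 192, 1536}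
    {4, 32, 137, 193, 200, 256, 2048}
    {5, 40, 201, 2560}
    {6}
    (by decide +kernel) (by decide +kernel) (by decide +kernel) (by decide +kernel) (by decide +kernel) (by decide +kernel) (by decide +kernel)
    rfl rfl rfl rfl rfl rfl rfl

theorem exists_8 : ∃ I : Ideal (MvPolynomial (Fin 4) K), IsAG 4 K I 6 ∧
      hilb 4 K I 0 = 1 ∧ hilb 4 K I 1 = 4 ∧ hilb 4 K I 2 = 7 ∧ hilb 4 K I 3 = 8 ∧
      hilb 4 K I 4 = 7 ∧ hilb 4 K I 5 = 4 ∧ hilb 4 K I 6 = 1 :=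
  build {146, 3072} (by decide +kernel) 3072 (by decide +kernel) 8
    {0}
    {1, 8, 64, 512}
    {2, 9, 16, 65, 72, 128, 1024}
    {10, 17, 66, 73, 80, 129, 136, 1536}
    {18, 74, 81, 130, 137, 144, 2048}
    {82, 138, 145, 2560}
    {146}
    (by decide +kernel) (by decide +kernel) (by decide +kernel) (by decide +kernel) (by decide +kernel) (by decide +kernel) (by decide +kernel)
    rfl rfl rfl rfl rfl rfl rfl

theorem exists_9 : ∃ I : Ideal (MvPolynomial (Fin 4) K), IsAG 4 K I 6 ∧
      hilb 4 K I 0 = 1 ∧ hilb 4 K I 1 = 4 ∧ hilb 4 K I 2 = 7 ∧ hilb 4 K I 3 = 9 ∧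
      hilb 4 K I 4 = 7 ∧ hilb 4 K I 5 = 4 ∧ hilb 4 K I 6 = 1 :=
  build {146, 3072, 6} (by decide +kernel) 3072 (by decide +kernel) 9
    {0}
    {1, 8, 64, 512}
    {2, 9, 16, 65, 72, 128, 1024}
    {3, 10, 17, 66, 73, 80, 129, 136, 1536}
    {4, 18, 74, 81, 130, 137, 2048}
    {5, 82, 138, 2560}
    {6}
    (by decide +kernel) (by decide +kernel) (by decide +kernel) (by decide +kernel) (by decide +kernel) (by decide +kernel) (by decide +kernel)
    rfl rfl rfl rfl rfl rfl rfl

theorem exists_10 : ∃ I : Ideal (MvPolynomial (Fin 4) K), IsAG 4 K I 6 ∧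
      hilb 4 K I 0 = 1 ∧ hilb 4 K I 1 = 4 ∧ hilb 4 K I 2 = 7 ∧ hilb 4 K I 3 = 10 ∧
      hilb 4 K I 4 = 7 ∧ hilb 4 K I 5 = 4 ∧ hilb 4 K I 6 = 1 :=
  build {146, 3072, 6, 48} (by decide +kernel) 3072 (by decide +kernel) 10
    {0}
    {1, 8, 64, 512}
    {2, 9, 16, 65, 72, 128, 1024}
    {3, 10, 17, 24, 66, 73, 80, 129, 136, 1536}
    {4, 18, 32, 74, 81, 137, 2048}
    {5, 40, 82, 2560}
    {6}
    (by decide +kernel) (by decide +kernel) (by decide +kernel) (by decide +kernel) (by decide +kernel) (by decide +kernel) (by decide +kernel)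
    rfl rfl rfl rfl rfl rfl rfl

theorem exists_11 : ∃ I : Ideal (MvPolynomial (Fin 4) K), IsAG 4 K I 6 ∧
      hilb 4 K I 0 = 1 ∧ hilb 4 K I 1 = 4 ∧ hilb 4 K I 2 = 7 ∧ hilb 4 K I 3 = 11 ∧
      hilb 4 K I 4 = 7 ∧ hilb 4 K I 5 = 4 ∧ hilb 4 K I 6 = 1 :=
  build {146, 3072, 6, 48, 384} (by decide +kernel) 3072 (by decide +kernel) 11
    {0}
    {1, 8, 64, 512}
    {2, 9, 16, 65, 72, 128, 1024}
    {3, 10, 17, 24, 66, 73, 80, 129, 136, 192, 1536}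
    {4, 18, 32, 74, 81, 137, 2048}
    {5, 40, 82, 2560}
    {6}
    (by decide +kernel) (by decide +kernel) (by decide +kernel) (by decide +kernel) (by decide +kernel) (by decide +kernel) (by decide +kernel)
    rfl rfl rfl rfl rfl rfl rfl

end Ex

/-- `H = (1,4,7,h,7,4,1)` is the Hilbert function of some
graded Artinian Gorenstein quotient of `K[w,x,y,z]` iff `7 ≤ h ≤ 11`. -/
theorem statement_2 {K : Type*} [Field K] [IsAlgClosed K] [CharZero K] (h : ℕ) :
    (∃ I : Ideal (MvPolynomial (Fin 4) K), IsAG 4 K I 6 ∧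
      hilb 4 K I 0 = 1 ∧ hilb 4 K I 1 = 4 ∧ hilb 4 K I 2 = 7 ∧ hilb 4 K I 3 = h ∧
      hilb 4 K I 4 = 7 ∧ hilb 4 K I 5 = 4 ∧ hilb 4 K I 6 = 1) ↔
    (7 ≤ h ∧ h ≤ 11) := by
  constructor
  · rintro ⟨I, hI, -, -, h2, h3, h4, -, h6⟩
    have := hI.2.1
    rw [← h3]
    exact ⟨lower_bound I hI h4 h6, macaulay_a I h2⟩
  · rintro ⟨h1, h2⟩
    interval_cases h
    · exact exists_7
    · exact exists_8
    · exact exists_9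
    · exact exists_10
    · exact exists_11

end
end
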